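/- arXiv:0902.3470 — 10 statements merged into one kernel-verified Lean document; each statement's English description precedes it below -/
import Mathlib

section
/- Let K be a field, let v, a₁, a₂ ∈ K with a₁ ≠ v² and a₂ ≠ v², and set bᵢ = (aᵢ·v² − 1)/(aᵢ − v²) for i = 1, 2. Then for all x, z ∈ K one has the identity (v² − a₂)(x² − a₁)(z² − b₂) − (v² − a₁)(x² − a₂)(z² − b₁) = (a₁ − a₂)·(x²z² − v²(x² + z²) + 1). -/
/-- Let `K` be a field, `v, a₁, a₂ ∈ K` with `a₁ ≠ v²` and `a₂ ≠ v²`, and set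
`bᵢ = (aᵢ·v² − 1)/(aᵢ − v²)`. Then for all `x, z ∈ K`:
`(v² − a₂)(x² − a₁)(z² − b₂) − (v² − a₁)(x² − a₂)(z² − b₁) = (a₁ − a₂)·S(x,z)`,
where `S(x,z) = x²z² − v²(x² + z²) + 1`. -/
theorem stmt_0 {K : Type*} [Field K] (v a₁ a₂ : K)
    (h₁ : a₁ ≠ v ^ 2) (h₂ : a₂ ≠ v ^ 2)
    (b₁ b₂ : K)
    (hb₁ : b₁ = (a₁ * v ^ 2 - 1) / (a₁ - v ^ 2))
    (hb₂ : b₂ = (a₂ * v ^ 2 - 1) / (a₂ - v ^ 2)) :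
    ∀ x z : K,
      (v ^ 2 - a₂) * (x ^ 2 - a₁) * (z ^ 2 - b₂)
        - (v ^ 2 - a₁) * (x ^ 2 - a₂) * (z ^ 2 - b₁)
      = (a₁ - a₂) * (x ^ 2 * z ^ 2 - v ^ 2 * (x ^ 2 + z ^ 2) + 1) := by
  intro x z
  have e₁ : b₁ * (a₁ - v ^ 2) = a₁ * v ^ 2 - 1 := by
    rw [hb₁, div_mul_cancel₀ _ (sub_ne_zero.mpr h₁)]
  have e₂ : b₂ * (a₂ - v ^ 2) = a₂ * v ^ 2 - 1 := by
    rw [hb₂, div_mul_cancel₀ _ (sub_ne_zero.mpr h₂)]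
  linear_combination (x ^ 2 - a₁) * e₂ - (x ^ 2 - a₂) * e₁
end

section
/- Let K be a field, g an even positive integer, v ∈ K, and a₁, …, a_g ∈ K with aᵢ ≠ v² for all i; set bᵢ = (aᵢ·v² − 1)/(aᵢ − v²). In the polynomial ring K[x,z], let S = x²z² − v²(x² + z²) + 1 and let M = (∏_{j=1}^{g/2} (v² − a_{2j})) · ∏_{j=1}^{g/2} (x² − a_{2j−1})(z² − b_{2j}). Then S divides the polynomial (∏_{i=1}^{g} (v² − aᵢ)(x² − aᵢ)(z² − bᵢ)) − M². -/
open MvPolynomial Finset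

theorem Finset.dvd_prod_sub_prod {ι R : Type*} [CommRing R] {d : R} (s : Finset ι) {f g : ι → R}
    (h : ∀ i ∈ s, d ∣ f i - g i) : d ∣ ∏ i ∈ s, f i - ∏ i ∈ s, g i := by
  simp only [← Ideal.mem_span_singleton, ← Ideal.Quotient.eq, map_prod] at h ⊢
  exact Finset.prod_congr rfl h

theorem Finset.prod_Icc_one_two_mul {M : Type*} [CommMonoid M] (f : ℕ → M) (n : ℕ) :
    ∏ i ∈ Finset.Icc 1 (2 * n), f i = ∏ j ∈ Finset.Icc 1 n, f (2 * j - 1) * f (2 * j) := by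
  induction n with
  | zero => simp
  | succ n ih =>
    rw [show 2 * (n + 1) = 2 * n + 1 + 1 by ring, Finset.prod_Icc_succ_top (by omega),
      Finset.prod_Icc_succ_top (by omega), ih, Finset.prod_Icc_succ_top (by omega), mul_assoc]
    rfl

/-- Modulo `x²z² - v²(x² + z²) + 1`, the element `(v² - a)(z² - b)` is `(x² - a)(z² - v²)`. -/
theorem C_mul_sq_sub_C_eq {K : Type*} [Field K] {v a b : K} (ha : a ≠ v ^ 2)
    (hb : b = (a * v ^ 2 - 1) / (a - v ^ 2)) (x z : MvPolynomial (Fin 2) K) :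
    C (v ^ 2 - a) * (z ^ 2 - C b) = (x ^ 2 - C a) * (z ^ 2 - C (v ^ 2)) -
      (x ^ 2 * z ^ 2 - C (v ^ 2) * (x ^ 2 + z ^ 2) + 1) := by
  have h : (v ^ 2 - a) * b = 1 - a * v ^ 2 := by
    rw [hb]
    field_simp [sub_ne_zero.mpr ha]
    ring
  have hC := congrArg (C (σ := Fin 2)) h
  simp only [map_mul, map_sub, map_one] at hC ⊢
  linear_combination -hC

/-- Let `K` be a field, `g` an even positive integer, `v ∈ K`, and `a₁, …, a_g ∈ K`
with `aᵢ ≠ v²`; set `bᵢ = (aᵢ·v² − 1)/(aᵢ − v²)`. In `K[x,z]`, with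
`S = x²z² − v²(x² + z²) + 1` and
`M = (∏_{j=1}^{g/2} (v² − a_{2j})) · ∏_{j=1}^{g/2} (x² − a_{2j−1})(z² − b_{2j})`,
the polynomial `S` divides `(∏_{i=1}^{g} (v² − aᵢ)(x² − aᵢ)(z² − bᵢ)) − M²`. -/
theorem stmt_2 {K : Type*} [Field K] (g : ℕ) (hg : 0 < g) (hge : Even g)
    (v : K) (a : ℕ → K) (ha : ∀ i ∈ Finset.Icc 1 g, a i ≠ v ^ 2)
    (b : ℕ → K) (hb : ∀ i ∈ Finset.Icc 1 g, b i = (a i * v ^ 2 - 1) / (a i - v ^ 2)) :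
    letI x : MvPolynomial (Fin 2) K := X 0
    letI z : MvPolynomial (Fin 2) K := X 1
    letI S : MvPolynomial (Fin 2) K :=
      x ^ 2 * z ^ 2 - C (v ^ 2) * (x ^ 2 + z ^ 2) + 1
    letI M : MvPolynomial (Fin 2) K :=
      C (∏ j ∈ Finset.Icc 1 (g / 2), (v ^ 2 - a (2 * j))) *
        ∏ j ∈ Finset.Icc 1 (g / 2), (x ^ 2 - C (a (2 * j - 1))) * (z ^ 2 - C (b (2 * j)))
    S ∣ (∏ i ∈ Finset.Icc 1 g,
          (C (v ^ 2 - a i) * (x ^ 2 - C (a i)) * (z ^ 2 - C (b i)))) - M ^ 2 := by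
  generalize (X 0 : MvPolynomial (Fin 2) K) = x, (X 1 : MvPolynomial (Fin 2) K) = z
  obtain ⟨n, rfl⟩ := hge.two_dvd
  have key : ∀ i ∈ Finset.Icc 1 (2 * n), C (v ^ 2 - a i) * (z ^ 2 - C (b i)) =
      (x ^ 2 - C (a i)) * (z ^ 2 - C (v ^ 2)) -
        (x ^ 2 * z ^ 2 - C (v ^ 2) * (x ^ 2 + z ^ 2) + 1) :=
    fun i hi => C_mul_sq_sub_C_eq (ha i hi) (hb i hi) x z
  rw [show (C (∏ j ∈ Finset.Icc 1 (2 * n / 2), (v ^ 2 - a (2 * j))) *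
        ∏ j ∈ Finset.Icc 1 (2 * n / 2),
          (x ^ 2 - C (a (2 * j - 1))) * (z ^ 2 - C (b (2 * j)))) ^ 2 =
      ∏ j ∈ Finset.Icc 1 n, ((x ^ 2 - C (a (2 * j - 1))) *
        (C (v ^ 2 - a (2 * j)) * (z ^ 2 - C (b (2 * j))))) ^ 2 by
    simp only [Nat.mul_div_cancel_left n two_pos, map_prod]
    rw [← Finset.prod_mul_distrib, Finset.prod_pow]
    congr 1
    exact Finset.prod_congr rfl fun j _ => by ring,
    Finset.prod_Icc_one_two_mul]
  refine Finset.dvd_prod_sub_prod _ fun j hj => ?_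
  rw [Finset.mem_Icc] at hj
  have ho := key (2 * j - 1) (Finset.mem_Icc.mpr (by omega))
  have he := key (2 * j) (Finset.mem_Icc.mpr (by omega))
  generalize x ^ 2 * z ^ 2 - C (v ^ 2) * (x ^ 2 + z ^ 2) + 1 = S at ho he ⊢
  set p := x ^ 2 - C (a (2 * j - 1))
  set p' := x ^ 2 - C (a (2 * j))
  set q' := C (v ^ 2 - a (2 * j)) * (z ^ 2 - C (b (2 * j))) with hq'
  refine ⟨p * q' * (p - p'), ?_⟩
  linear_combination p * p' * q' * ho - p * p * q' * he -
    p' * C (v ^ 2 - a (2 * j - 1)) * p * (z ^ 2 - C (b (2 * j - 1))) * hq'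
end

section
/- Let K be a field, g an even positive integer, v ∈ K, and a₁, …, a_g ∈ K with aᵢ ≠ v² for all i; set bᵢ = (aᵢ·v² − 1)/(aᵢ − v²), A = 2(v² + 1)·∏_{i=1}^{g}(v² − aᵢ), and in K[x,z] let S = x²z² − v²(x² + z²) + 1 and M = (∏_{j=1}^{g/2} (v² − a_{2j})) · ∏_{j=1}^{g/2} (x² − a_{2j−1})(z² − b_{2j}). Then S divides the polynomial A·(x − v)(vx − 1)·(∏_{i=1}^{g}(x² − aᵢ))·(z − v)(vz − 1)·(∏_{i=1}^{g}(z² − bᵢ)) − ((v² + 1)(1 − vx − vz + xz)·M)². (This identity shows that the equations S(x,z) = 0, yt = (v²+1)(1 − vx − vz + xz)·M(x,z) define a correspondence between the hyperelliptic curves y² = A·(x−v)(vx−1)∏(x²−aᵢ) and t² = (z−v)(vz−1)∏(z²−bᵢ).) -/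
open MvPolynomial Finset

/-- If `(w - c) * (u - a i) = (c - a i) * (w - b i)` for `1 ≤ i ≤ 2n`, then the product over all `i`
of `(c - a i) * (u - a i) * (w - b i)` is an explicit square. -/
theorem prod_mul_prod_mul_prod_eq_sq {R : Type*} [CommRing R] (c u w : R) (a b : ℕ → R) (n : ℕ)
    (h : ∀ i ∈ Finset.Icc 1 (2 * n), (w - c) * (u - a i) = (c - a i) * (w - b i)) :
    (∏ i ∈ Finset.Icc 1 (2 * n), (c - a i)) * (∏ i ∈ Finset.Icc 1 (2 * n), (u - a i)) *
        (∏ i ∈ Finset.Icc 1 (2 * n), (w - b i)) =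
      ((∏ j ∈ Finset.Icc 1 n, (c - a (2 * j))) *
        ∏ j ∈ Finset.Icc 1 n, (u - a (2 * j - 1)) * (w - b (2 * j))) ^ 2 := by
  induction n with
  | zero => simp
  | succ n ih =>
    have ih' := ih fun i hi => h i (by simp only [Finset.mem_Icc] at hi ⊢; omega)
    have h₁ := h (2 * n + 1) (by simp only [Finset.mem_Icc]; omega)
    have h₂ := h (2 * n + 2) (by simp only [Finset.mem_Icc]; omega)
    have e₁ : 2 * (n + 1) = 2 * n + 1 + 1 := by ring
    have e₂ : 2 * n + 1 + 1 - 1 = 2 * n + 1 := rfl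
    simp only [Finset.prod_Icc_succ_top (Nat.le_add_left 1 _), e₁, e₂]
    set P := ∏ i ∈ Finset.Icc 1 (2 * n), (c - a i)
    set Q := ∏ i ∈ Finset.Icc 1 (2 * n), (u - a i)
    set T := ∏ i ∈ Finset.Icc 1 (2 * n), (w - b i)
    have key : (c - a (2 * n + 1)) * (c - a (2 * n + 2)) * (u - a (2 * n + 1)) *
        (u - a (2 * n + 2)) * (w - b (2 * n + 1)) * (w - b (2 * n + 2)) =
        ((c - a (2 * n + 2)) * (u - a (2 * n + 1)) * (w - b (2 * n + 2))) ^ 2 := by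
      linear_combination
        (-(c - a (2 * n + 2)) * (u - a (2 * n + 1)) * (u - a (2 * n + 2)) *
          (w - b (2 * n + 2))) * h₁ +
        ((c - a (2 * n + 2)) * (u - a (2 * n + 1)) ^ 2 * (w - b (2 * n + 2))) * h₂
    calc _ = P * Q * T * ((c - a (2 * n + 1)) * (c - a (2 * n + 2)) * (u - a (2 * n + 1)) *
          (u - a (2 * n + 2)) * (w - b (2 * n + 1)) * (w - b (2 * n + 2))) := by ring
      _ = _ := by rw [ih', key]; ring

/-- Let `K` be a field, `g` an even positive integer, `v ∈ K`, `a₁, …, a_g ∈ K` with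
`aᵢ ≠ v²`; set `bᵢ = (aᵢ·v² − 1)/(aᵢ − v²)`, `A = 2(v² + 1)·∏_{i=1}^{g}(v² − aᵢ)`, and
in `K[x,z]` let `S = x²z² − v²(x² + z²) + 1` and
`M = (∏_{j=1}^{g/2} (v² − a_{2j})) · ∏_{j=1}^{g/2} (x² − a_{2j−1})(z² − b_{2j})`.
Then `S` divides
`A·(x − v)(vx − 1)·(∏ᵢ(x² − aᵢ))·(z − v)(vz − 1)·(∏ᵢ(z² − bᵢ))
  − ((v² + 1)(1 − vx − vz + xz)·M)²`. -/
theorem stmt_3 {K : Type*} [Field K] (g : ℕ) (hg : 0 < g) (hge : Even g)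
    (v : K) (a : ℕ → K) (ha : ∀ i ∈ Finset.Icc 1 g, a i ≠ v ^ 2)
    (b : ℕ → K) (hb : ∀ i ∈ Finset.Icc 1 g, b i = (a i * v ^ 2 - 1) / (a i - v ^ 2))
    (A : K) (hA : A = 2 * (v ^ 2 + 1) * ∏ i ∈ Finset.Icc 1 g, (v ^ 2 - a i)) :
    letI x : MvPolynomial (Fin 2) K := X 0
    letI z : MvPolynomial (Fin 2) K := X 1
    letI S : MvPolynomial (Fin 2) K :=
      x ^ 2 * z ^ 2 - C (v ^ 2) * (x ^ 2 + z ^ 2) + 1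
    letI M : MvPolynomial (Fin 2) K :=
      C (∏ j ∈ Finset.Icc 1 (g / 2), (v ^ 2 - a (2 * j))) *
        ∏ j ∈ Finset.Icc 1 (g / 2), (x ^ 2 - C (a (2 * j - 1))) * (z ^ 2 - C (b (2 * j)))
    S ∣ C A * (x - C v) * (C v * x - 1) * (∏ i ∈ Finset.Icc 1 g, (x ^ 2 - C (a i))) *
          ((z - C v) * (C v * z - 1)) * (∏ i ∈ Finset.Icc 1 g, (z ^ 2 - C (b i)))
        - (C (v ^ 2 + 1) * (1 - C v * x - C v * z + x * z) * M) ^ 2 := by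
  let x : MvPolynomial (Fin 2) K := X 0
  let z : MvPolynomial (Fin 2) K := X 1
  let S : MvPolynomial (Fin 2) K := x ^ 2 * z ^ 2 - C (v ^ 2) * (x ^ 2 + z ^ 2) + 1
  change S ∣ _
  obtain ⟨n, rfl⟩ := hge.two_dvd
  let q := Ideal.Quotient.mk (Ideal.span {S})
  have hS : q S = 0 := Ideal.Quotient.eq_zero_iff_mem.2 (Ideal.mem_span_singleton_self S)
  have hS' : q x ^ 2 * q z ^ 2 - q (C v) ^ 2 * (q x ^ 2 + q z ^ 2) + 1 = 0 := by
    simpa only [S, map_add, map_sub, map_mul, map_pow, map_one] using hS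
  have hab : ∀ i ∈ Finset.Icc 1 (2 * n),
      (q z ^ 2 - q (C v) ^ 2) * (q x ^ 2 - q (C (a i))) =
        (q (C v) ^ 2 - q (C (a i))) * (q z ^ 2 - q (C (b i))) := by
    intro i hi
    have hb' : b i * (a i - v ^ 2) = a i * v ^ 2 - 1 := by
      rw [hb i hi, div_mul_cancel₀ _ (sub_ne_zero.2 (ha i hi))]
    have hq := congrArg (fun t => q (C t)) hb'
    simp only [map_sub, map_mul, map_pow, map_one] at hq
    linear_combination hS' - hq
  have hprod := prod_mul_prod_mul_prod_eq_sq _ _ _ _ _ n hab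
  have hn : 2 * n / 2 = n := by omega
  rw [← Ideal.mem_span_singleton, ← Ideal.Quotient.eq_zero_iff_mem]
  change q _ = 0
  simp only [hA, hn, map_sub, map_mul, map_pow, map_one, map_add, map_prod, map_ofNat] at hprod ⊢
  set c := q (C v)
  linear_combination
    (2 * (c ^ 2 + 1) * (q x - c) * (c * q x - 1) * (q z - c) * (c * q z - 1)) * hprod +
    ((c ^ 2 + 1) * (c ^ 2 - 1) * ((∏ j ∈ Finset.Icc 1 n, (c ^ 2 - q (C (a (2 * j))))) *
      ((∏ j ∈ Finset.Icc 1 n, (q x ^ 2 - q (C (a (2 * j - 1)))) *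
        (q z ^ 2 - q (C (b (2 * j))))))) ^ 2) * hS'
end

section
/- Let K be a field and v ∈ K with v⁴ ≠ 1. If X, x, z ∈ K satisfy X²z² − v²(X² + z²) + 1 = 0 and x²z² − v²(x² + z²) + 1 = 0, then x² = X². (This is the key computation showing that the composed correspondence Γ′∘Γ sends a point of abscissa X to points of abscissa ±X, hence acts as multiplication by 2 on Pic⁰ of the curve.) -/
/-- Let `K` be a field and `v ∈ K` with `v⁴ ≠ 1`. If `X, x, z ∈ K` satisfy
`S(X,z) = 0` and `S(x,z) = 0`, where `S(x,z) = x²z² − v²(x² + z²) + 1`,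
then `x² = X²`. -/
theorem stmt_4 {K : Type*} [Field K] (v : K) (hv : v ^ 4 ≠ 1)
    (X x z : K)
    (hX : X ^ 2 * z ^ 2 - v ^ 2 * (X ^ 2 + z ^ 2) + 1 = 0)
    (hx : x ^ 2 * z ^ 2 - v ^ 2 * (x ^ 2 + z ^ 2) + 1 = 0) :
    x ^ 2 = X ^ 2 := by
  have hprod : (x ^ 2 - X ^ 2) * (z ^ 2 - v ^ 2) = 0 := by
    linear_combination hx - hX
  rcases mul_eq_zero.mp hprod with h | h
  · exact sub_eq_zero.mp h
  · exact absurd (by linear_combination (x ^ 2 - v ^ 2) * h - hx) hv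
end

section
/- Let K be a field of characteristic different from 2 and let a₁, a₂, a₃, a₄, a₅, a₆ ∈ K be pairwise distinct. Then the following are equivalent: (i) there exists a 2×2 matrix m = [[p, q], [r, −p]] over K with trace zero and determinant −p² − qr ≠ 0 such that the induced fractional linear involution h(x) = (px + q)/(rx − p) satisfies h(a₁) = a₂, h(a₃) = a₄, h(a₅) = a₆ (i.e. p·a_{2i−1} + q = a_{2i}·(r·a_{2i−1} − p) for i = 1, 2, 3); (ii) a₃a₅a₆ + a₄a₅a₆ + a₁a₂a₅ + a₁a₂a₆ + a₁a₃a₄ + a₂a₃a₄ = a₁a₅a₆ + a₂a₅a₆ + a₃a₄a₅ + a₃a₄a₆ + a₁a₂a₃ + a₁a₂a₄. -/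
/-- Let `K` be a field of characteristic `≠ 2` and `a₁, …, a₆ ∈ K` pairwise distinct.
Then there exists a trace-zero matrix `[[p, q], [r, −p]]` with determinant
`−p² − qr ≠ 0` whose induced fractional linear involution `h(x) = (px+q)/(rx−p)`
satisfies `h(a₁) = a₂`, `h(a₃) = a₄`, `h(a₅) = a₆` (expressed by
`p·a_{2i−1} + q = a_{2i}·(r·a_{2i−1} − p)`), if and only if
`a₃a₅a₆ + a₄a₅a₆ + a₁a₂a₅ + a₁a₂a₆ + a₁a₃a₄ + a₂a₃a₄
  = a₁a₅a₆ + a₂a₅a₆ + a₃a₄a₅ + a₃a₄a₆ + a₁a₂a₃ + a₁a₂a₄`. -/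
theorem stmt_5 {K : Type*} [Field K] (hchar : (2 : K) ≠ 0)
    (a₁ a₂ a₃ a₄ a₅ a₆ : K)
    (hdist : List.Pairwise (· ≠ ·) [a₁, a₂, a₃, a₄, a₅, a₆]) :
    (∃ p q r : K, -p ^ 2 - q * r ≠ 0 ∧
        p * a₁ + q = a₂ * (r * a₁ - p) ∧
        p * a₃ + q = a₄ * (r * a₃ - p) ∧
        p * a₅ + q = a₆ * (r * a₅ - p))
      ↔ a₃ * a₅ * a₆ + a₄ * a₅ * a₆ + a₁ * a₂ * a₅ + a₁ * a₂ * a₆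
          + a₁ * a₃ * a₄ + a₂ * a₃ * a₄
        = a₁ * a₅ * a₆ + a₂ * a₅ * a₆ + a₃ * a₄ * a₅ + a₃ * a₄ * a₆
          + a₁ * a₂ * a₃ + a₁ * a₂ * a₄ := by
  constructor
  · rintro ⟨p, q, r, hdet, h₁, h₂, h₃⟩
    by_contra hne
    have hne' := sub_ne_zero.mpr hne
    have hp : p = 0 := by
      refine (mul_eq_zero.mp ?_).resolve_right hne'
      linear_combination (a₁ * a₂ - a₅ * a₆) * (h₁ - h₂) - (a₁ * a₂ - a₃ * a₄) * (h₁ - h₃)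
    have hr : r = 0 := by
      refine (mul_eq_zero.mp ?_).resolve_right hne'
      linear_combination (a₁ + a₂ - a₅ - a₆) * (h₁ - h₂) - (a₁ + a₂ - a₃ - a₄) * (h₁ - h₃)
    simp [hp, hr] at hdet
  · intro h
    refine ⟨a₁ * a₂ - a₃ * a₄, (a₁ + a₂) * (a₃ * a₄) - (a₃ + a₄) * (a₁ * a₂),
      a₁ + a₂ - a₃ - a₄, ?_, by ring, by ring, by linear_combination h⟩
    have hdet : -(a₁ * a₂ - a₃ * a₄) ^ 2
        - ((a₁ + a₂) * (a₃ * a₄) - (a₃ + a₄) * (a₁ * a₂)) * (a₁ + a₂ - a₃ - a₄)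
        = -((a₁ - a₃) * (a₁ - a₄) * ((a₂ - a₃) * (a₂ - a₄))) := by ring
    rw [hdet]
    simp only [List.pairwise_cons, List.mem_cons, forall_eq_or_imp] at hdist
    obtain ⟨⟨-, h₁₃, h₁₄, -⟩, ⟨h₂₃, h₂₄, -⟩, -⟩ := hdist
    simp [sub_eq_zero, h₁₃, h₁₄, h₂₃, h₂₄]
end

section
/- Let g ≥ 3, let L be a field of characteristic 0, and let v, x₁, …, x_g ∈ L be algebraically independent over ℚ. Suppose h is a fractional linear transformation with coefficients in L (induced by an invertible 2×2 matrix over L), defined at each of the 2g+2 pairwise distinct points v, 1/v, x₁, −x₁, …, x_g, −x_g, and suppose there exist w, y₁, …, y_g ∈ L such that, as sets, {h(v), h(1/v), h(x₁), h(−x₁), …, h(x_g), h(−x_g)} = {w, 1/w, y₁, −y₁, …, y_g, −y_g}, the latter set also having 2g+2 elements. Then h is one of the four maps x ↦ x, x ↦ −x, x ↦ 1/x, x ↦ −1/x. -/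
/-- The `3 × 3` determinant with rows `(1, a + b, a * b)`, `(1, c + d, c * d)`,
`(1, e + f, e * f)`. Its vanishing means that some Möbius involution exchanges the members of each
of the pairs `{a, b}`, `{c, d}`, `{e, f}`. -/
def involutionDet {L : Type*} [CommRing L] (a b c d e f : L) : L :=
  ((c + d) * (e * f) - (e + f) * (c * d)) - (a + b) * (e * f - c * d)
    + a * b * ((e + f) - (c + d))

/-- The point exchanged with a given one, on the other sheet of the same index. -/
def conjIndex {ι : Type*} (k : ι × Bool) : ι × Bool := (k.1, !k.2)

section conjIndex

variable {ι : Type*}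

theorem conjIndex_conjIndex (k : ι × Bool) : conjIndex (conjIndex k) = k := by
  simp [conjIndex]

theorem conjIndex_ne (k : ι × Bool) : conjIndex k ≠ k := by
  rcases k with ⟨i, _ | _⟩ <;> simp [conjIndex]

theorem fst_conjIndex (k : ι × Bool) : (conjIndex k).1 = k.1 := rfl

theorem eq_or_eq_conjIndex_of_fst_eq {k l : ι × Bool} (h : k.1 = l.1) :
    k = l ∨ k = conjIndex l := by
  rcases k with ⟨i, _ | _⟩ <;> rcases l with ⟨j, _ | _⟩ <;> simp_all [conjIndex]

end conjIndex

/-- The family `u o, (u o)⁻¹` together with `u i, -u i` for `i ≠ o`. -/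
def pairedPoints {ι L : Type*} [DecidableEq ι] [Field L] (o : ι) (u : ι → L) (k : ι × Bool) : L :=
  if k.2 then u k.1 else if k.1 = o then (u k.1)⁻¹ else -u k.1

section pairedPoints

variable {ι L : Type*} [DecidableEq ι] [Field L] (o : ι) (u : ι → L)

theorem pairedPoints_conjIndex_of_ne {k : ι × Bool} (hk : k.1 ≠ o) :
    pairedPoints o u (conjIndex k) = -pairedPoints o u k := by
  rcases k with ⟨i, _ | _⟩ <;> simp_all [conjIndex, pairedPoints]

theorem pairedPoints_conjIndex_of_eq {k : ι × Bool} (hk : k.1 = o) :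
    pairedPoints o u (conjIndex k) = (pairedPoints o u k)⁻¹ := by
  rcases k with ⟨i, _ | _⟩ <;> simp_all [conjIndex, pairedPoints]

theorem pairedPoints_mem {K : Subfield L} {k : ι × Bool} (h : u k.1 ∈ K) :
    pairedPoints o u k ∈ K := by
  unfold pairedPoints
  split_ifs
  exacts [h, K.inv_mem h, K.neg_mem h]

end pairedPoints

/-- The elements `u i` are generic up to degree two: each of them satisfies no nontrivial
quadratic relation over a subfield containing all the others. -/
def QuadraticallyIndependent {ι L : Type*} [Field L] (u : ι → L) : Prop :=
  ∀ i, ∃ K : Subfield L, (∀ j, j ≠ i → u j ∈ K) ∧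
    ∀ A ∈ K, ∀ B ∈ K, ∀ C ∈ K, A * u i ^ 2 + B * u i + C = 0 → A = 0 ∧ B = 0 ∧ C = 0

theorem Transcendental.quadratic_eq_zero {K L : Type*} [Field K] [Field L] [Algebra K L] {t : L}
    (ht : Transcendental K t) {A B C : K}
    (h : algebraMap K L A * t ^ 2 + algebraMap K L B * t + algebraMap K L C = 0) :
    A = 0 ∧ B = 0 ∧ C = 0 := by
  have hp : (Polynomial.C A * Polynomial.X ^ 2 + Polynomial.C B * Polynomial.X
      + Polynomial.C C : Polynomial K) = 0 :=
    (transcendental_iff.mp ht) _ (by simpa using h)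
  refine ⟨?_, ?_, ?_⟩
  · simpa [Polynomial.coeff_X, Polynomial.coeff_C] using congrArg (Polynomial.coeff · 2) hp
  · simpa [Polynomial.coeff_X, Polynomial.coeff_C] using congrArg (Polynomial.coeff · 1) hp
  · simpa [Polynomial.coeff_X, Polynomial.coeff_C] using congrArg (Polynomial.coeff · 0) hp

theorem AlgebraicIndependent.quadraticallyIndependent {ι L : Type*} [Field L] [CharZero L]
    {u : ι → L} (hu : AlgebraicIndependent ℚ u) : QuadraticallyIndependent u := by
  intro i
  have ht : Transcendental (IntermediateField.adjoin ℚ (u '' {i}ᶜ)) (u i) :=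
    IntermediateField.transcendental_adjoin_iff.mpr (hu.transcendental_adjoin (by simp))
  refine ⟨(IntermediateField.adjoin ℚ (u '' {i}ᶜ)).toSubfield, fun j hj ↦
    IntermediateField.subset_adjoin _ _ ⟨j, hj, rfl⟩, fun A hA B hB C hC h ↦ ?_⟩
  simpa [Subtype.ext_iff] using ht.quadratic_eq_zero (A := ⟨A, hA⟩) (B := ⟨B, hB⟩) (C := ⟨C, hC⟩) h

section involutionDet

variable {ι L : Type*} [DecidableEq ι] [Field L] {o : ι} {u : ι → L}

theorem QuadraticallyIndependent.pairedPoints (hu : QuadraticallyIndependent u) (o : ι)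
    (k : ι × Bool) :
    ∃ K : Subfield L, (∀ l : ι × Bool, l.1 ≠ k.1 → pairedPoints o u l ∈ K) ∧
      ∀ A ∈ K, ∀ B ∈ K, ∀ C ∈ K,
        A * pairedPoints o u k ^ 2 + B * pairedPoints o u k + C = 0 → A = 0 ∧ B = 0 ∧ C = 0 := by
  obtain ⟨K, hK, hq⟩ := hu k.1
  refine ⟨K, fun l hl ↦ pairedPoints_mem o u (hK _ hl), fun A hA B hB C hC h ↦ ?_⟩
  have h0 : u k.1 ≠ 0 := fun h0 ↦ one_ne_zero
    (hq 1 K.one_mem 0 K.zero_mem 0 K.zero_mem (by simp [h0])).1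
  unfold _root_.pairedPoints at h
  split_ifs at h
  · exact hq A hA B hB C hC h
  · have := hq C hC B hB A hA (by field_simp at h; linear_combination h)
    tauto
  · have := hq A hA (-B) (K.neg_mem hB) C hC (by linear_combination h)
    simpa using this

theorem QuadraticallyIndependent.pairedPoints_ne_zero (hu : QuadraticallyIndependent u)
    (k : ι × Bool) : _root_.pairedPoints o u k ≠ 0 := by
  obtain ⟨K, -, hq⟩ := hu.pairedPoints o k
  exact fun h0 ↦ one_ne_zero (hq 1 K.one_mem 0 K.zero_mem 0 K.zero_mem (by simp [h0])).1

theorem QuadraticallyIndependent.pairedPoints_injective [CharZero L]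
    (hu : QuadraticallyIndependent u) : Function.Injective (_root_.pairedPoints o u) := by
  intro k l h
  obtain ⟨K, hK, hq⟩ := hu.pairedPoints o k
  by_cases hkl : k.1 = l.1
  · refine (eq_or_eq_conjIndex_of_fst_eq hkl).resolve_right fun hk ↦ ?_
    obtain rfl : l = conjIndex k := by rw [hk, conjIndex_conjIndex]
    have h0 := hu.pairedPoints_ne_zero (o := o) k
    by_cases ho : k.1 = o
    · rw [pairedPoints_conjIndex_of_eq o u ho] at h
      field_simp at h
      exact one_ne_zero (hq 1 K.one_mem 0 K.zero_mem (-1) (K.neg_mem K.one_mem)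
        (by linear_combination h)).1
    · rw [pairedPoints_conjIndex_of_ne o u ho] at h
      exact h0 (self_eq_neg.mp h)
  · have := hq 0 K.zero_mem 1 K.one_mem (-_root_.pairedPoints o u l)
      (K.neg_mem (hK l (Ne.symm hkl))) (by linear_combination h)
    exact absurd this.2.1 one_ne_zero

/-- Six distinct indices whose points form three pairs exchanged by a Möbius involution. -/
def IsInvolutive (o : ι) (u : ι → L) (k₁ l₁ k₂ l₂ k₃ l₃ : ι × Bool) : Prop :=
  [k₁, l₁, k₂, l₂, k₃, l₃].Nodup ∧
    involutionDet (pairedPoints o u k₁) (pairedPoints o u l₁) (pairedPoints o u k₂)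
      (pairedPoints o u l₂) (pairedPoints o u k₃) (pairedPoints o u l₃) = 0

variable {k₁ l₁ k₂ l₂ k₃ l₃ : ι × Bool}

theorem IsInvolutive.swap (h : IsInvolutive o u k₁ l₁ k₂ l₂ k₃ l₃) :
    IsInvolutive o u l₁ k₁ k₂ l₂ k₃ l₃ := by
  refine ⟨by have := h.1; grind, ?_⟩
  have := h.2
  unfold involutionDet at *
  linear_combination this

theorem IsInvolutive.rotate (h : IsInvolutive o u k₁ l₁ k₂ l₂ k₃ l₃) :
    IsInvolutive o u k₂ l₂ k₃ l₃ k₁ l₁ := by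
  refine ⟨by have := h.1; grind, ?_⟩
  have := h.2
  unfold involutionDet at *
  linear_combination this

theorem IsInvolutive.exchange (h : IsInvolutive o u k₁ l₁ k₂ l₂ k₃ l₃) :
    IsInvolutive o u k₁ l₁ k₃ l₃ k₂ l₂ := by
  refine ⟨by have := h.1; grind, ?_⟩
  have := h.2
  unfold involutionDet at *
  linear_combination -this

/-- If the index `k₁` occurred only once, its point would be determined by the others. -/
theorem IsInvolutive.conjIndex_mem [CharZero L] (hu : QuadraticallyIndependent u)
    (h : IsInvolutive o u k₁ l₁ k₂ l₂ k₃ l₃) :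
    l₁ = conjIndex k₁ ∨ k₂ = conjIndex k₁ ∨ l₂ = conjIndex k₁ ∨ k₃ = conjIndex k₁ ∨
      l₃ = conjIndex k₁ := by
  by_contra! hne
  have hnd := h.1
  obtain ⟨K, hK, hq⟩ := hu.pairedPoints o k₁
  have key : ∀ l, l ≠ k₁ → l ≠ conjIndex k₁ → pairedPoints o u l ∈ K := fun l h₁ h₂ ↦
    hK l fun he ↦ (eq_or_eq_conjIndex_of_fst_eq he).elim h₁ h₂
  have hb := key l₁ (by grind) (by grind)
  have hc := key k₂ (by grind) (by grind)
  have hd := key l₂ (by grind) (by grind)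
  have he := key k₃ (by grind) (by grind)
  have hf := key l₃ (by grind) (by grind)
  have hinj := hu.pairedPoints_injective (o := o)
  have hbd : pairedPoints o u l₁ ≠ pairedPoints o u l₂ := hinj.ne (by grind)
  have hce : pairedPoints o u k₂ ≠ pairedPoints o u k₃ := hinj.ne (by grind)
  have hcf : pairedPoints o u k₂ ≠ pairedPoints o u l₃ := hinj.ne (by grind)
  have hdet := h.2
  unfold involutionDet at hdet
  generalize pairedPoints o u k₁ = a at *
  generalize pairedPoints o u l₁ = b at *
  generalize pairedPoints o u k₂ = c at *
  generalize pairedPoints o u l₂ = d at *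
  generalize pairedPoints o u k₃ = e at *
  generalize pairedPoints o u l₃ = f at *
  obtain ⟨-, hB, hC⟩ := hq 0 K.zero_mem (b * ((e + f) - (c + d)) - (e * f - c * d))
    (K.sub_mem (K.mul_mem hb (K.sub_mem (K.add_mem he hf) (K.add_mem hc hd)))
      (K.sub_mem (K.mul_mem he hf) (K.mul_mem hc hd)))
    (((c + d) * (e * f) - (e + f) * (c * d)) - b * (e * f - c * d))
    (K.sub_mem (K.sub_mem (K.mul_mem (K.add_mem hc hd) (K.mul_mem he hf))
      (K.mul_mem (K.add_mem he hf) (K.mul_mem hc hd)))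
      (K.mul_mem hb (K.sub_mem (K.mul_mem he hf) (K.mul_mem hc hd))))
    (by linear_combination hdet)
  have : (b - d) * (c - e) * (c - f) = 0 := by linear_combination -c * hB - hC
  simp [sub_eq_zero, hbd, hce, hcf] at this

/-- Three conjugate pairs are exchanged by a Möbius involution only if none of them is the
reciprocal pair. -/
theorem IsInvolutive.fst_ne (hu : QuadraticallyIndependent u)
    (h : IsInvolutive o u k₁ (conjIndex k₁) k₂ (conjIndex k₂) k₃ (conjIndex k₃)) :
    k₁.1 ≠ o := by
  intro ho
  have hnd := h.1
  have h₁₂ : k₁.1 ≠ k₂.1 := fun he ↦ by grind [eq_or_eq_conjIndex_of_fst_eq he]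
  have h₁₃ : k₁.1 ≠ k₃.1 := fun he ↦ by grind [eq_or_eq_conjIndex_of_fst_eq he]
  have h₂₃ : k₂.1 ≠ k₃.1 := fun he ↦ by grind [eq_or_eq_conjIndex_of_fst_eq he]
  have hdet := h.2
  rw [pairedPoints_conjIndex_of_eq o u ho, pairedPoints_conjIndex_of_ne o u (ho ▸ h₁₂.symm),
    pairedPoints_conjIndex_of_ne o u (ho ▸ h₁₃.symm)] at hdet
  have h0 := hu.pairedPoints_ne_zero (o := o) k₁
  obtain ⟨K, hK, hq⟩ := hu.pairedPoints o k₁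
  obtain ⟨M, hM, hr⟩ := hu.pairedPoints o k₂
  have hm := hM k₃ h₂₃.symm
  unfold involutionDet at hdet
  field_simp at hdet
  generalize pairedPoints o u k₁ = v at *
  generalize pairedPoints o u k₂ = x at *
  generalize pairedPoints o u k₃ = y at *
  have : (v ^ 2 + 1) * (x ^ 2 - y ^ 2) = 0 := by linear_combination -hdet
  rcases mul_eq_zero.mp this with h' | h'
  · exact one_ne_zero (hq 1 K.one_mem 0 K.zero_mem 1 K.one_mem (by linear_combination h')).1
  · exact one_ne_zero (hr 1 M.one_mem 0 M.zero_mem (-y ^ 2)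
      (by simpa using M.neg_mem (M.pow_mem hm 2)) (by linear_combination h')).1

theorem IsInvolutive.not_conj_of_fst_eq [CharZero L] (hu : QuadraticallyIndependent u)
    {k l m : ι × Bool} (hl : l.1 = o) :
    ¬ IsInvolutive o u k (conjIndex k) l m (conjIndex l) (conjIndex m) := by
  intro h
  have hnd := h.1
  have hkl : k.1 ≠ l.1 := fun he ↦ by grind [eq_or_eq_conjIndex_of_fst_eq he]
  have hkm : k.1 ≠ m.1 := fun he ↦ by grind [eq_or_eq_conjIndex_of_fst_eq he]
  have hlm : l.1 ≠ m.1 := fun he ↦ by grind [eq_or_eq_conjIndex_of_fst_eq he]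
  have hdet := h.2
  rw [pairedPoints_conjIndex_of_eq o u hl, pairedPoints_conjIndex_of_ne o u (hl ▸ hkl),
    pairedPoints_conjIndex_of_ne o u (hl ▸ hlm.symm)] at hdet
  obtain ⟨K, hK, hq⟩ := hu.pairedPoints o k
  obtain ⟨M, hM, hr⟩ := hu.pairedPoints o m
  have hKl := hK l hkl.symm
  have hKm := hK m hkm.symm
  have hMl := hM l hlm
  unfold involutionDet at hdet
  generalize pairedPoints o u k = a at *
  generalize pairedPoints o u l = v at *
  generalize pairedPoints o u m = e at *
  obtain ⟨hA, -, -⟩ := hq ((v + e) - (v⁻¹ + -e))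
    (K.sub_mem (K.add_mem hKl hKm) (K.add_mem (K.inv_mem hKl) (K.neg_mem hKm))) 0 K.zero_mem
    ((v + e) * (v⁻¹ * -e) - (v⁻¹ + -e) * (v * e))
    (K.sub_mem (K.mul_mem (K.add_mem hKl hKm) (K.mul_mem (K.inv_mem hKl) (K.neg_mem hKm)))
      (K.mul_mem (K.add_mem (K.inv_mem hKl) (K.neg_mem hKm)) (K.mul_mem hKl hKm)))
    (by linear_combination hdet)
  exact two_ne_zero (hr 0 M.zero_mem 2 (ofNat_mem M 2) (v - v⁻¹)
    (M.sub_mem hMl (M.inv_mem hMl)) (by linear_combination hA)).2.1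

theorem IsInvolutive.not_conj [CharZero L] (hu : QuadraticallyIndependent u) {k l m : ι × Bool} :
    ¬ IsInvolutive o u k (conjIndex k) l m (conjIndex l) (conjIndex m) := by
  intro h
  by_cases hl : l.1 = o
  · exact not_conj_of_fst_eq hu hl h
  by_cases hm : m.1 = o
  · exact not_conj_of_fst_eq hu hm h.rotate.swap.rotate.swap.rotate
  have hnd := h.1
  have hkl : k.1 ≠ l.1 := fun he ↦ by grind [eq_or_eq_conjIndex_of_fst_eq he]
  have hlm : l.1 ≠ m.1 := fun he ↦ by grind [eq_or_eq_conjIndex_of_fst_eq he]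
  have hdet := h.2
  rw [pairedPoints_conjIndex_of_ne o u hl, pairedPoints_conjIndex_of_ne o u hm] at hdet
  have h0 := hu.pairedPoints_ne_zero (o := o) m
  obtain ⟨K, hK, hq⟩ := hu.pairedPoints o l
  have hKk := hK k hkl
  have hKk' := hK (conjIndex k) hkl
  have hKm := hK m hlm.symm
  have hsum : pairedPoints o u l + pairedPoints o u m ≠ 0 := fun hs ↦ one_ne_zero
    (hq 0 K.zero_mem 1 K.one_mem _ hKm (by linear_combination hs)).2.1
  unfold involutionDet at hdet
  generalize pairedPoints o u k = a at *
  generalize pairedPoints o u (conjIndex k) = b at *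
  generalize pairedPoints o u l = c at *
  generalize pairedPoints o u m = e at *
  have : (c + e) * (c * e - a * b) = 0 := by
    refine (mul_eq_zero.mp ?_).resolve_left (two_ne_zero (α := L))
    linear_combination hdet
  exact h0 (hq 0 K.zero_mem e hKm (-(a * b)) (K.neg_mem (K.mul_mem hKk hKk'))
    (by linear_combination (mul_eq_zero.mp this).resolve_left hsum)).2.1

theorem IsInvolutive.not_cycle_of_fst_eq (hu : QuadraticallyIndependent u) {k l m : ι × Bool}
    (hk : k.1 = o) :
    ¬ IsInvolutive o u k l (conjIndex k) m (conjIndex l) (conjIndex m) := by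
  intro h
  have hnd := h.1
  have hkl : k.1 ≠ l.1 := fun he ↦ by grind [eq_or_eq_conjIndex_of_fst_eq he]
  have hkm : k.1 ≠ m.1 := fun he ↦ by grind [eq_or_eq_conjIndex_of_fst_eq he]
  have hlm : l.1 ≠ m.1 := fun he ↦ by grind [eq_or_eq_conjIndex_of_fst_eq he]
  have hdet := h.2
  rw [pairedPoints_conjIndex_of_eq o u hk, pairedPoints_conjIndex_of_ne o u (hk ▸ hkl.symm),
    pairedPoints_conjIndex_of_ne o u (hk ▸ hkm.symm)] at hdet
  obtain ⟨K, hK, hq⟩ := hu.pairedPoints o l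
  obtain ⟨M, hM, hr⟩ := hu.pairedPoints o m
  have hKk := hK k hkl
  have hKm := hK m hlm.symm
  have hMk := hM k hkm
  have hsum : pairedPoints o u m + pairedPoints o u k ≠ 0 := fun hs ↦ one_ne_zero
    (hr 0 M.zero_mem 1 M.one_mem _ hMk (by linear_combination hs)).2.1
  unfold involutionDet at hdet
  generalize pairedPoints o u k = v at *
  generalize pairedPoints o u l = c at *
  generalize pairedPoints o u m = e at *
  have hKv := K.inv_mem hKk
  have hC : v⁻¹ * e ^ 2 + v * v⁻¹ * e ∈ K :=
    K.add_mem (K.mul_mem hKv (K.pow_mem hKm 2)) (K.mul_mem (K.mul_mem hKk hKv) hKm)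
  have hB : e ^ 2 + 3 * (v⁻¹ * e) - 3 * (v * e) - v * v⁻¹ ∈ K :=
    K.sub_mem (K.sub_mem (K.add_mem (K.pow_mem hKm 2)
      (K.mul_mem (ofNat_mem K 3) (K.mul_mem hKv hKm)))
      (K.mul_mem (ofNat_mem K 3) (K.mul_mem hKk hKm))) (K.mul_mem hKk hKv)
  exact neg_ne_zero.mpr hsum (hq (-(e + v)) (K.neg_mem (K.add_mem hKm hKk)) _ hB _ hC
    (by linear_combination hdet)).1

theorem IsInvolutive.not_cycle (hu : QuadraticallyIndependent u) {k l m : ι × Bool} :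
    ¬ IsInvolutive o u k l (conjIndex k) m (conjIndex l) (conjIndex m) := by
  intro h
  by_cases hk : k.1 = o
  · exact not_cycle_of_fst_eq hu hk h
  by_cases hl : l.1 = o
  · refine not_cycle_of_fst_eq hu (k := l) (l := k) (m := conjIndex m) hl ?_
    rw [conjIndex_conjIndex]
    exact h.swap.exchange
  by_cases hm : m.1 = o
  · refine not_cycle_of_fst_eq hu (k := m) (l := conjIndex k) (m := conjIndex l) hm ?_
    rw [conjIndex_conjIndex, conjIndex_conjIndex]
    exact h.rotate.swap.rotate.swap.rotate.rotate
  have hnd := h.1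
  have hkl : k.1 ≠ l.1 := fun he ↦ by grind [eq_or_eq_conjIndex_of_fst_eq he]
  have hkm : k.1 ≠ m.1 := fun he ↦ by grind [eq_or_eq_conjIndex_of_fst_eq he]
  have hlm : l.1 ≠ m.1 := fun he ↦ by grind [eq_or_eq_conjIndex_of_fst_eq he]
  have hdet := h.2
  rw [pairedPoints_conjIndex_of_ne o u hk, pairedPoints_conjIndex_of_ne o u hl,
    pairedPoints_conjIndex_of_ne o u hm] at hdet
  obtain ⟨K, hK, hq⟩ := hu.pairedPoints o k
  have hKl := hK l hkl.symm
  have hKm := hK m hkm.symm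
  have hne : pairedPoints o u l - pairedPoints o u m ≠ 0 := fun hs ↦ by
    obtain ⟨M, hM, hr⟩ := hu.pairedPoints o l
    exact one_ne_zero (hr 0 M.zero_mem 1 M.one_mem _ (M.neg_mem (hM m hlm.symm))
      (by linear_combination hs)).2.1
  unfold involutionDet at hdet
  generalize pairedPoints o u k = a at *
  generalize pairedPoints o u l = c at *
  generalize pairedPoints o u m = e at *
  have hB : -(c ^ 2 + 6 * (c * e) + e ^ 2) ∈ K :=
    K.neg_mem (K.add_mem (K.add_mem (K.pow_mem hKl 2)
      (K.mul_mem (ofNat_mem K 6) (K.mul_mem hKl hKm))) (K.pow_mem hKm 2))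
  have hC : -(c * e * (c - e)) ∈ K :=
    K.neg_mem (K.mul_mem (K.mul_mem hKl hKm) (K.sub_mem hKl hKm))
  exact hne (hq (c - e) (K.sub_mem hKl hKm) _ hB _ hC (by linear_combination hdet)).1

theorem IsInvolutive.eq_conjIndex_of_eq [CharZero L] (hu : QuadraticallyIndependent u)
    (h : IsInvolutive o u k₁ (conjIndex k₁) k₂ l₂ k₃ l₃) : l₂ = conjIndex k₂ := by
  by_contra hne
  have hnd := h.1
  have hcc := conjIndex_conjIndex (ι := ι)
  have aux : ∀ k₃ l₃, IsInvolutive o u k₁ (conjIndex k₁) k₂ l₂ k₃ l₃ → k₃ ≠ conjIndex k₂ := by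
    rintro _ l₃ h rfl
    have hnd := h.1
    have hl : l₃ = conjIndex l₂ := by
      have := h.rotate.swap.conjIndex_mem hu
      grind
    exact not_conj hu (hl ▸ h)
  have := h.rotate.conjIndex_mem hu
  have h₁ := aux _ _ h
  have h₂ := aux _ _ h.rotate.rotate.swap.rotate
  grind

theorem IsInvolutive.ne_conjIndex [CharZero L] (hu : QuadraticallyIndependent u)
    (h : IsInvolutive o u k₁ l₁ k₂ l₂ k₃ l₃) : k₂ ≠ conjIndex k₁ := by
  rintro rfl
  have hnd := h.1
  have hcc := conjIndex_conjIndex (ι := ι)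
  have aux : ∀ k₃ l₃, IsInvolutive o u k₁ l₁ (conjIndex k₁) l₂ k₃ l₃ → k₃ ≠ conjIndex l₁ := by
    rintro _ l₃ h rfl
    have hnd := h.1
    have hl : l₃ = conjIndex l₂ := by
      have := h.rotate.swap.conjIndex_mem hu
      grind
    exact not_cycle hu (hl ▸ h)
  have := h.swap.conjIndex_mem hu
  have h₁ := aux _ _ h
  have h₂ := aux _ _ h.rotate.rotate.swap.rotate
  have h₃ : l₂ = conjIndex l₁ → False := by
    rintro rfl
    have : l₃ = conjIndex k₃ := by
      have := h.rotate.rotate.conjIndex_mem hu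
      grind
    exact not_conj hu (this ▸ h).rotate.rotate
  grind

/-- A Möbius involution exchanging three disjoint pairs among generic points is `t ↦ -t`. -/
theorem IsInvolutive.conj_and_ne [CharZero L] (hu : QuadraticallyIndependent u)
    (h : IsInvolutive o u k₁ l₁ k₂ l₂ k₃ l₃) : l₁ = conjIndex k₁ ∧ k₁.1 ≠ o := by
  have hl : l₁ = conjIndex k₁ := by
    have h₁ := h.ne_conjIndex hu
    have h₂ := h.rotate.swap.rotate.rotate.ne_conjIndex hu
    have h₃ := h.exchange.ne_conjIndex hu
    have h₄ := h.rotate.rotate.swap.rotate.exchange.ne_conjIndex hu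
    have := h.conjIndex_mem hu
    tauto
  subst hl
  obtain rfl := h.eq_conjIndex_of_eq hu
  obtain rfl := h.exchange.eq_conjIndex_of_eq hu
  exact ⟨rfl, h.fst_ne hu⟩

end involutionDet

theorem range_pairedPoints_cons {L : Type*} [Field L] {g : ℕ} (v : L) (x : Fin g → L) :
    Set.range (pairedPoints 0 (Fin.cons v x : Fin (g + 1) → L))
      = {v, v⁻¹} ∪ ⋃ i, {x i, -(x i)} := by
  ext t
  simp only [Set.mem_range, Prod.exists, Fin.exists_fin_succ, Bool.exists_bool, pairedPoints,
    Set.mem_union, Set.mem_iUnion, Set.mem_insert_iff, Set.mem_singleton_iff]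
  simp [Fin.succ_ne_zero, eq_comm, or_comm]

theorem pairedPoints_injective_of_ncard {L : Type*} [Field L] {g : ℕ} {w : L} {y : Fin g → L}
    (h : (({w, w⁻¹} ∪ ⋃ i, {y i, -(y i)}) : Set L).ncard = 2 * g + 2) :
    Function.Injective (pairedPoints 0 (Fin.cons w y : Fin (g + 1) → L)) := by
  classical
  rw [← range_pairedPoints_cons, ← Set.image_univ, ← Finset.coe_univ, ← Finset.coe_image,
    Set.ncard_coe_finset] at h
  have := Finset.card_image_iff.mp (h.trans (by simp; ring :
    2 * g + 2 = (Finset.univ : Finset (Fin (g + 1) × Bool)).card))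
  simpa using this

/-- Three pairs whose members are exchanged by the conjugate of `t ↦ -t` under a Möbius
transformation have vanishing determinant. -/
theorem involutionDet_eq_zero {L : Type*} [Field L] [CharZero L] {a b c d : L}
    (habcd : a * d - b * c ≠ 0) {s₁ t₁ s₂ t₂ s₃ t₃ : L}
    (h₁ : (a * s₁ + b) * (c * t₁ + d) + (a * t₁ + b) * (c * s₁ + d) = 0)
    (h₂ : (a * s₂ + b) * (c * t₂ + d) + (a * t₂ + b) * (c * s₂ + d) = 0)
    (h₃ : (a * s₃ + b) * (c * t₃ + d) + (a * t₃ + b) * (c * s₃ + d) = 0) :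
    involutionDet s₁ t₁ s₂ t₂ s₃ t₃ = 0 := by
  have e₁ : 2 * (b * d) * involutionDet s₁ t₁ s₂ t₂ s₃ t₃ = 0 := by
    unfold involutionDet
    linear_combination ((s₂ + t₂) * (s₃ * t₃) - (s₃ + t₃) * (s₂ * t₂)) * h₁
      + ((s₃ + t₃) * (s₁ * t₁) - (s₁ + t₁) * (s₃ * t₃)) * h₂
      + ((s₁ + t₁) * (s₂ * t₂) - (s₂ + t₂) * (s₁ * t₁)) * h₃
  have e₂ : (a * d + b * c) * involutionDet s₁ t₁ s₂ t₂ s₃ t₃ = 0 := by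
    unfold involutionDet
    linear_combination (s₂ * t₂ - s₃ * t₃) * h₁ + (s₃ * t₃ - s₁ * t₁) * h₂
      + (s₁ * t₁ - s₂ * t₂) * h₃
  have e₃ : 2 * (a * c) * involutionDet s₁ t₁ s₂ t₂ s₃ t₃ = 0 := by
    unfold involutionDet
    linear_combination ((s₃ + t₃) - (s₂ + t₂)) * h₁ + ((s₁ + t₁) - (s₃ + t₃)) * h₂
      + ((s₂ + t₂) - (s₁ + t₁)) * h₃
  refine (mul_eq_zero.mp ?_).resolve_left (pow_ne_zero 2 habcd)
  linear_combination (a * d + b * c) * e₂ - 2 * (b * d) * e₃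

/-- Let `g ≥ 3`, `L` a field of characteristic `0`, and `v, x₁, …, x_g ∈ L`
algebraically independent over `ℚ`. Suppose `h(t) = (at+b)/(ct+d)` (with
`ad − bc ≠ 0`) is defined at each of the `2g+2` pairwise distinct points
`v, 1/v, x₁, −x₁, …, x_g, −x_g`, and there are `w, y₁, …, y_g ∈ L` with
`h({v, 1/v, x₁, −x₁, …}) = {w, 1/w, y₁, −y₁, …, y_g, −y_g}` as sets, the latter
also having `2g+2` elements. Then `h` is one of `x ↦ x`, `x ↦ −x`, `x ↦ 1/x`,
`x ↦ −1/x` (i.e. `b = c = 0` and `a = ±d`, or `a = d = 0` and `b = ±c`). -/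
theorem stmt_9 {L : Type*} [Field L] [CharZero L] (g : ℕ) (hg : 3 ≤ g)
    (v : L) (x : Fin g → L)
    (hind : AlgebraicIndependent ℚ (Fin.cons v x : Fin (g + 1) → L))
    (a b c d : L) (habcd : a * d - b * c ≠ 0)
    (w : L) (y : Fin g → L)
    (hsrc : (({v, v⁻¹} ∪ ⋃ i, {x i, -(x i)}) : Set L).ncard = 2 * g + 2)
    (htgt : (({w, w⁻¹} ∪ ⋃ i, {y i, -(y i)}) : Set L).ncard = 2 * g + 2)
    (hdef : ∀ t ∈ (({v, v⁻¹} ∪ ⋃ i, {x i, -(x i)}) : Set L), c * t + d ≠ 0)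
    (himg : (fun t => (a * t + b) / (c * t + d)) ''
        (({v, v⁻¹} ∪ ⋃ i, {x i, -(x i)}) : Set L)
      = (({w, w⁻¹} ∪ ⋃ i, {y i, -(y i)}) : Set L)) :
    (b = 0 ∧ c = 0 ∧ (a = d ∨ a = -d)) ∨ (a = 0 ∧ d = 0 ∧ (b = c ∨ b = -c)) := by
  set p := pairedPoints 0 (Fin.cons v x : Fin (g + 1) → L) with hp
  set q := pairedPoints 0 (Fin.cons w y : Fin (g + 1) → L) with hq
  have hu := hind.quadraticallyIndependent
  have hqinj : Function.Injective q := pairedPoints_injective_of_ncard htgt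
  have hpinj : Function.Injective p := hu.pairedPoints_injective
  rw [← range_pairedPoints_cons] at hdef himg
  rw [← range_pairedPoints_cons, ← Set.range_comp] at himg
  have hden : ∀ k, c * p k + d ≠ 0 := fun k ↦ hdef _ ⟨k, rfl⟩
  have hZ : ∀ k, ∃ l, (a * p l + b) / (c * p l + d) = q k := fun k ↦ by
    have : q k ∈ Set.range q := ⟨k, rfl⟩
    rwa [← himg] at this
  choose Z hZ using hZ
  have hZ' : ∀ k, a * p (Z k) + b = q k * (c * p (Z k) + d) := fun k ↦
    (div_eq_iff (hden _)).mp (hZ k)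
  have hZinj : Function.Injective Z := fun k l h ↦ hqinj (by rw [← hZ, ← hZ, h])
  have hZsurj : Function.Surjective Z := Finite.surjective_of_injective hZinj
  have hpair : ∀ i : Fin (g + 1), i ≠ 0 →
      (a * p (Z (i, true)) + b) * (c * p (Z (i, false)) + d)
        + (a * p (Z (i, false)) + b) * (c * p (Z (i, true)) + d) = 0 := fun i hi ↦ by
    have : q (i, false) = -q (i, true) :=
      pairedPoints_conjIndex_of_ne 0 (Fin.cons w y : Fin (g + 1) → L) (k := (i, true)) hi
    rw [hZ', hZ', this]
    ring
  have hthree : ∀ i : Fin (g + 1), i ≠ 0 → ∃ j l, j ≠ 0 ∧ l ≠ 0 ∧ i ≠ j ∧ i ≠ l ∧ j ≠ l :=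
    fun i hi ↦ by
      have hcard : 1 < (Finset.univ \ {0, i} : Finset (Fin (g + 1))).card := by
        rw [Finset.card_sdiff_of_subset (Finset.subset_univ _), Finset.card_pair hi.symm]
        simp only [Finset.card_univ, Fintype.card_fin]
        omega
      obtain ⟨j, hj, l, hl, hjl⟩ := Finset.one_lt_card.mp hcard
      simp at hj hl
      exact ⟨j, l, hj.1, hl.1, Ne.symm hj.2, Ne.symm hl.2, hjl⟩
  have hconj : ∀ i : Fin (g + 1), i ≠ 0 →
      Z (i, false) = conjIndex (Z (i, true)) ∧ (Z (i, true)).1 ≠ 0 := fun i hi ↦ by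
    obtain ⟨j, l, hj, hl, hij, hil, hjl⟩ := hthree i hi
    refine IsInvolutive.conj_and_ne hu (k₂ := Z (j, true)) (l₂ := Z (j, false))
      (k₃ := Z (l, true)) (l₃ := Z (l, false)) ⟨?_, ?_⟩
    · simp [hZinj.eq_iff, hij, hil, hjl]
    · exact involutionDet_eq_zero habcd (hpair i hi) (hpair j hj) (hpair l hl)
  have hsq : ∀ i : Fin (g + 1), i ≠ 0 → a * c * p (Z (i, true)) ^ 2 = b * d := fun i hi ↦ by
    have h := hpair i hi
    rw [(hconj i hi).1, hp, pairedPoints_conjIndex_of_ne 0 _ (hconj i hi).2] at h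
    refine mul_left_cancel₀ (two_ne_zero (α := L)) ?_
    linear_combination -h
  have hac : a * c = 0 := by
    have hi : (⟨1, by omega⟩ : Fin (g + 1)) ≠ 0 := by simp [Fin.ext_iff]
    obtain ⟨j, -, hj, -, hij, -⟩ := hthree _ hi
    generalize (⟨1, by omega⟩ : Fin (g + 1)) = i at hi hij
    by_contra hne
    have : p (Z (i, true)) ^ 2 = p (Z (j, true)) ^ 2 :=
      mul_left_cancel₀ hne ((hsq i hi).trans (hsq j hj).symm)
    rcases sq_eq_sq_iff_eq_or_eq_neg.mp this with h | h
    · exact hij (Prod.ext_iff.mp (hZinj (hpinj h))).1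
    · rw [hp, ← pairedPoints_conjIndex_of_ne 0 _ (hconj j hj).2, ← (hconj j hj).1] at h
      exact hij (Prod.ext_iff.mp (hZinj (hpinj h))).1
  have hbd : b * d = 0 := by
    rw [← hsq ⟨1, by omega⟩ (by simp [Fin.ext_iff]), hac, zero_mul]
  have hpre : ∀ k, (Z k).1 = 0 → k.1 = 0 := by
    rintro ⟨i, s⟩ hk
    by_contra hi
    have := hconj i hi
    cases s
    · exact this.2 (by rwa [this.1, fst_conjIndex] at hk)
    · exact this.2 hk
  obtain ⟨k, hk⟩ := hZsurj (0, true)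
  obtain ⟨l, hl⟩ := hZsurj (0, false)
  have hk0 : k.1 = 0 := hpre k (by rw [hk])
  have hl0 : l.1 = 0 := hpre l (by rw [hl])
  have hkl : l = conjIndex k := (eq_or_eq_conjIndex_of_fst_eq (hl0.trans hk0.symm)).resolve_left
    fun h ↦ by simp [h ▸ hk] at hl
  have hq0 : q k ≠ 0 := fun h0 ↦ by
    have : q (conjIndex k) = q k := by
      rw [hq, pairedPoints_conjIndex_of_eq 0 _ hk0, ← hq, h0, inv_zero]
    exact conjIndex_ne k (hqinj this)
  have hv0 : v ≠ 0 := hu.pairedPoints_ne_zero (o := 0) (0, true)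
  have hqk := hZ k
  have hql := hZ l
  have hdk := hden (Z k)
  have hdl := hden (Z l)
  have hpk : p (0, true) = v := by simp [hp, pairedPoints]
  have hpl : p (0, false) = v⁻¹ := by simp [hp, pairedPoints]
  rw [hk, hpk] at hqk hdk
  rw [hl, hpl] at hql hdl
  have hprod : (a * v + b) * (a * v⁻¹ + b) = (c * v + d) * (c * v⁻¹ + d) := by
    have : q k * q l = 1 := by
      rw [hkl, hq, pairedPoints_conjIndex_of_eq 0 _ hk0, ← hq, mul_inv_cancel₀ hq0]
    rw [← hqk, ← hql, div_mul_div_comm, div_eq_one_iff_eq (mul_ne_zero hdk hdl)] at this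
    exact this
  rcases mul_eq_zero.mp hac with rfl | rfl
  · have hb : b ≠ 0 := by rintro rfl; simp at habcd
    obtain rfl : d = 0 := (mul_eq_zero.mp hbd).resolve_left hb
    refine Or.inr ⟨rfl, rfl, sq_eq_sq_iff_eq_or_eq_neg.mp ?_⟩
    linear_combination hprod + c ^ 2 * mul_inv_cancel₀ hv0
  · have hd : d ≠ 0 := by rintro rfl; simp at habcd
    obtain rfl : b = 0 := (mul_eq_zero.mp hbd).resolve_right hd
    refine Or.inl ⟨rfl, rfl, sq_eq_sq_iff_eq_or_eq_neg.mp ?_⟩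
    linear_combination hprod - a ^ 2 * mul_inv_cancel₀ hv0
end

section
/- Let L be a field of characteristic 0 and let v, x₁, x₂ ∈ L be algebraically independent over ℚ. Then there is no Möbius involution over L mapping the six-element set B₁ = {x₁, −x₁, x₂, −x₂, v, 1/v} onto itself. -/
open MvPolynomial in
/-- A polynomial over `ℤ` vanishing at algebraically independent elements vanishes everywhere. -/
theorem AlgebraicIndependent.eval_int_eq_zero {ι L : Type*} [Field L] [CharZero L] {t : ι → L}
    (ht : AlgebraicIndependent ℚ t) {p : MvPolynomial ι ℤ} (hp : aeval t p = 0) (z : ι → ℤ) :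
    aeval z p = 0 := by
  have hind : AlgebraicIndependent ℤ t := ht.restrictScalars (Int.cast_injective (α := ℚ))
  rw [(algebraicIndependent_iff.mp hind) p hp, map_zero]

namespace SixPoints

/-- Numerators of the six points `x₁, -x₁, x₂, -x₂, v, 1/v`, where `t = ![v, x₁, x₂]`. -/
def num {R : Type*} [CommRing R] (t : Fin 3 → R) : Fin 6 → R :=
  ![t 1, -t 1, t 2, -t 2, t 0, 1]

/-- Denominators of the six points `x₁, -x₁, x₂, -x₂, v, 1/v`, where `t = ![v, x₁, x₂]`. -/
def den {R : Type*} [CommRing R] (t : Fin 3 → R) : Fin 6 → R :=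
  ![1, 1, 1, 1, 1, t 0]

/-- The cross product of the homogeneous coordinates of two of the six points. -/
def cross {R : Type*} [CommRing R] (t : Fin 3 → R) (i j : Fin 6) : R :=
  num t i * den t j - num t j * den t i

/-- The determinant of the conditions on an involution to exchange `i` with `i'`, `j` with `j'`
and `k` with `k'`. -/
def involutionDet {R : Type*} [CommRing R] (t : Fin 3 → R) (i i' j j' k k' : Fin 6) : R :=
  let P (i j : Fin 6) := den t i * den t j
  let Q (i j : Fin 6) := num t i * den t j + num t j * den t i
  let S (i j : Fin 6) := num t i * num t j
  P i i' * (Q j j' * S k k' - S j j' * Q k k') - Q i i' * (P j j' * S k k' - S j j' * P k k') +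
    S i i' * (P j j' * Q k k' - Q j j' * P k k')

section Map

variable {R A : Type*} [CommRing R] [CommRing A] (f : R →+* A) (t : Fin 3 → R)

theorem map_num (i : Fin 6) : f (num t i) = num (f ∘ t) i := by
  fin_cases i <;> simp [num]

theorem map_den (i : Fin 6) : f (den t i) = den (f ∘ t) i := by
  fin_cases i <;> simp [den]

theorem map_cross (i j : Fin 6) : f (cross t i j) = cross (f ∘ t) i j := by
  simp [cross, map_num, map_den]

theorem map_involutionDet (i i' j j' k k' : Fin 6) :
    f (involutionDet t i i' j j' k k') = involutionDet (f ∘ t) i i' j j' k k' := by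
  simp [involutionDet, map_num, map_den]

end Map

theorem cross_int_ne_zero : ∀ i j : Fin 6, i ≠ j → cross (![3, 2, 4] : Fin 3 → ℤ) i j ≠ 0 := by
  decide +kernel

theorem involutionDet_int_ne_zero : ∀ i i' j : Fin 6, j ≠ i → j ≠ i' → ∀ j', j' ≠ i → j' ≠ i' →
    ∀ k, k ≠ i → k ≠ i' → k ≠ j → k ≠ j' → ∀ k', k' ≠ i → k' ≠ i' → k' ≠ j → k' ≠ j' →
    involutionDet (![3, 2, 4] : Fin 3 → ℤ) i i' j j' k k' ≠ 0 := by
  decide +kernel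

section Generic

variable {L : Type*} [Field L] [CharZero L] {t : Fin 3 → L}

theorem cross_ne_zero (ht : AlgebraicIndependent ℚ t) {i j : Fin 6} (hij : i ≠ j) :
    cross t i j ≠ 0 := by
  intro h
  have key := ht.eval_int_eq_zero (p := cross MvPolynomial.X i j) (by
    rw [← AlgHom.coe_toRingHom, map_cross]
    convert h
    ext; simp) ![3, 2, 4]
  rw [← AlgHom.coe_toRingHom, map_cross] at key
  refine cross_int_ne_zero i j hij ?_
  convert key
  ext; simp

theorem involutionDet_ne_zero (ht : AlgebraicIndependent ℚ t) {i i' j j' k k' : Fin 6}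
    (h₁ : j ≠ i) (h₂ : j ≠ i') (h₃ : j' ≠ i) (h₄ : j' ≠ i')
    (h₅ : k ≠ i) (h₆ : k ≠ i') (h₇ : k ≠ j) (h₈ : k ≠ j')
    (h₉ : k' ≠ i) (h₁₀ : k' ≠ i') (h₁₁ : k' ≠ j) (h₁₂ : k' ≠ j') :
    involutionDet t i i' j j' k k' ≠ 0 := by
  intro h
  have key := ht.eval_int_eq_zero (p := involutionDet MvPolynomial.X i i' j j' k k') (by
    rw [← AlgHom.coe_toRingHom, map_involutionDet]
    convert h
    ext; simp) ![3, 2, 4]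
  rw [← AlgHom.coe_toRingHom, map_involutionDet] at key
  refine involutionDet_int_ne_zero i i' j h₁ h₂ j' h₃ h₄ k h₅ h₆ h₇ h₈ k' h₉ h₁₀ h₁₁ h₁₂ ?_
  convert key
  ext; simp

end Generic

theorem exists_ne_of_four : ∀ a b c d : Fin 6, ∃ k, k ≠ a ∧ k ≠ b ∧ k ≠ c ∧ k ≠ d := by
  decide +kernel

/-- A nonzero symmetric bilinear condition satisfied by three pairs forces the determinant of
the pairs to vanish. -/
theorem involutionDet_eq_zero {L : Type*} [Field L] {t : Fin 3 → L} {a b c : L}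
    (h : a ≠ 0 ∨ b ≠ 0 ∨ c ≠ 0) {σ : Fin 6 → Fin 6}
    (hσ : ∀ i, c * (num t i * num t (σ i)) - a * (num t i * den t (σ i) + num t (σ i) * den t i)
      - b * (den t i * den t (σ i)) = 0) (i j k : Fin 6) :
    involutionDet t i (σ i) j (σ j) k (σ k) = 0 := by
  have hi := hσ i
  have hj := hσ j
  have hk := hσ k
  simp only [involutionDet]
  generalize num t i * num t (σ i) = s₁ at *
  generalize num t j * num t (σ j) = s₂ at *
  generalize num t k * num t (σ k) = s₃ at *
  generalize den t i * den t (σ i) = p₁ at *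
  generalize den t j * den t (σ j) = p₂ at *
  generalize den t k * den t (σ k) = p₃ at *
  generalize num t i * den t (σ i) + num t (σ i) * den t i = q₁ at *
  generalize num t j * den t (σ j) + num t (σ j) * den t j = q₂ at *
  generalize num t k * den t (σ k) + num t (σ k) * den t k = q₃ at *
  rcases h with h | h | h <;> refine (mul_eq_zero.mp ?_).resolve_left h
  · linear_combination (p₂ * s₃ - s₂ * p₃) * hi - (p₁ * s₃ - s₁ * p₃) * hj
      + (p₁ * s₂ - s₁ * p₂) * hk
  · linear_combination -(q₂ * s₃ - s₂ * q₃) * hi + (q₁ * s₃ - s₁ * q₃) * hj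
      - (q₁ * s₂ - s₁ * q₂) * hk
  · linear_combination (p₂ * q₃ - q₂ * p₃) * hi - (p₁ * q₃ - q₁ * p₃) * hj
      + (p₁ * q₂ - q₁ * p₂) * hk

theorem points_eq_range {L : Type*} [Field L] (v x₁ x₂ : L) :
    ({x₁, -x₁, x₂, -x₂, v, v⁻¹} : Set L) =
      Set.range fun i ↦ num ![v, x₁, x₂] i / den ![v, x₁, x₂] i := by
  ext y
  simp [num, den, Fin.exists_fin_succ, eq_comm]

/-- No trace-zero Möbius transformation maps the six points to themselves when `t` is
algebraically independent. -/
theorem not_mapsTo_points {L : Type*} [Field L] [CharZero L] {t : Fin 3 → L}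
    (ht : AlgebraicIndependent ℚ t) {a b c : L} (habc : a ≠ 0 ∨ b ≠ 0 ∨ c ≠ 0)
    (hden : ∀ i, c * (num t i / den t i) + -a ≠ 0) :
    ¬ ∀ i, ∃ j, num t j / den t j =
      (a * (num t i / den t i) + b) / (c * (num t i / den t i) + -a) := by
  intro hex
  have hD (i) : den t i ≠ 0 := by fin_cases i <;> simp [den, ht.ne_zero 0]
  choose σ hσ using hex
  have hrel (i : Fin 6) : c * (num t i * num t (σ i))
      - a * (num t i * den t (σ i) + num t (σ i) * den t i) - b * (den t i * den t (σ i)) = 0 := by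
    have h := hσ i
    rw [eq_div_iff (hden i)] at h
    have h1 := hD i
    have h2 := hD (σ i)
    field_simp at h
    linear_combination h
  have hinv (i : Fin 6) : σ (σ i) = i := by
    by_contra hne
    refine cross_ne_zero ht hne ?_
    rw [cross, sub_eq_zero, ← div_eq_div_iff (hD _) (hD _), hσ, div_eq_iff (hden _)]
    have h := hrel i
    have h1 := hD i
    have h2 := hD (σ i)
    field_simp
    linear_combination -h
  obtain ⟨j, hj, hj', -, -⟩ := exists_ne_of_four 0 (σ 0) 0 0
  obtain ⟨k, hk₁, hk₂, hk₃, hk₄⟩ := exists_ne_of_four 0 (σ 0) j (σ j)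
  have hswap {i j : Fin 6} (h : j ≠ σ i) : σ j ≠ i := fun e ↦ h (by rw [← e, hinv])
  have hinj {i j : Fin 6} (h : j ≠ i) : σ j ≠ σ i := fun e ↦ h (by rw [← hinv j, e, hinv])
  exact involutionDet_ne_zero ht hj hj' (hswap hj') (hinj hj) hk₁ hk₂ hk₃ hk₄
    (hswap hk₂) (hinj hk₁) (hswap hk₄) (hinj hk₃) (involutionDet_eq_zero habc hrel 0 j k)

end SixPoints

/-- A non-scalar `2 × 2` matrix with scalar square has trace zero. -/
theorem Matrix.add_eq_zero_of_sq_scalar {L : Type*} [Field L] {a b c d k : L}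
    (hns : ¬ ∃ k : L, !![a, b; c, d] = k • (1 : Matrix (Fin 2) (Fin 2) L))
    (hk : !![a, b; c, d] * !![a, b; c, d] = k • (1 : Matrix (Fin 2) (Fin 2) L)) :
    a + d = 0 := by
  have h00 := congr_fun₂ hk 0 0
  have h01 := congr_fun₂ hk 0 1
  have h10 := congr_fun₂ hk 1 0
  have h11 := congr_fun₂ hk 1 1
  simp [Matrix.mul_apply, Fin.sum_univ_two] at h00 h01 h10 h11
  by_contra had
  have hb : b = 0 := (mul_eq_zero.mp (by linear_combination h01 : (a + d) * b = 0)).resolve_left had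
  have hc : c = 0 := (mul_eq_zero.mp (by linear_combination h10 : (a + d) * c = 0)).resolve_left had
  have hd : a - d = 0 :=
    (mul_eq_zero.mp (by linear_combination h00 - h11 : (a + d) * (a - d) = 0)).resolve_left had
  refine hns ⟨a, ?_⟩
  ext i j
  fin_cases i <;> fin_cases j <;> simp [hb, hc, (sub_eq_zero.mp hd).symm]

/-- Let `L` be a field of characteristic `0` and `v, x₁, x₂ ∈ L` algebraically
independent over `ℚ`. Then there is no Möbius involution over `L` (a map
`t ↦ (at+b)/(ct+d)`, `ad − bc ≠ 0`, not the identity but of square the identity,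
encoded on the matrix `!![a,b;c,d]`: not scalar, but with scalar square) mapping
the six-element set `B₁ = {x₁, −x₁, x₂, −x₂, v, 1/v}` onto itself. -/
theorem stmt_11 {L : Type*} [Field L] [CharZero L] (v x₁ x₂ : L)
    (hind : AlgebraicIndependent ℚ ![v, x₁, x₂]) :
    ¬ ∃ a b c d : L, a * d - b * c ≠ 0 ∧
      (¬ ∃ k : L, !![a, b; c, d] = k • (1 : Matrix (Fin 2) (Fin 2) L)) ∧
      (∃ k : L, !![a, b; c, d] * !![a, b; c, d] = k • (1 : Matrix (Fin 2) (Fin 2) L)) ∧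
      (∀ t ∈ ({x₁, -x₁, x₂, -x₂, v, v⁻¹} : Set L), c * t + d ≠ 0) ∧
      (fun t => (a * t + b) / (c * t + d)) '' ({x₁, -x₁, x₂, -x₂, v, v⁻¹} : Set L)
        = ({x₁, -x₁, x₂, -x₂, v, v⁻¹} : Set L) := by
  rintro ⟨a, b, c, d, hdet, hns, ⟨k, hk⟩, hden, himg⟩
  obtain rfl : d = -a :=
    eq_neg_of_add_eq_zero_right (Matrix.add_eq_zero_of_sq_scalar hns hk)
  rw [SixPoints.points_eq_range] at hden himg
  refine SixPoints.not_mapsTo_points hind (a := a) (b := b) (c := c) ?_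
    (fun i ↦ hden _ ⟨i, rfl⟩) fun i ↦ Set.mem_range.mp (himg ▸ ⟨_, ⟨i, rfl⟩, rfl⟩)
  by_contra! h
  obtain ⟨rfl, rfl, rfl⟩ := h
  simp at hdet
end

section
/- Let K be an algebraically closed field of characteristic 0 and let p₁, …, p₆ ∈ K be algebraically independent over ℚ. Then there exist a fractional linear transformation h over K (defined at p₁, …, p₆) and elements x₁, x₂, v ∈ K with v ≠ 0 such that h(p₁) = x₁, h(p₂) = −x₁, h(p₃) = x₂, h(p₄) = −x₂, h(p₅) = v, h(p₆) = 1/v. In other words, six generic points of the projective line can be written, in a suitable coordinate, in the form {x₁, −x₁, x₂, −x₂, v, 1/v}; consequently the generic hyperelliptic curve of genus 2 has an equation of the form y² = (x − v)(vx − 1)(x² − a₁)(x² − a₂). -/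
/-- A polynomial that is nonzero at some rational point does not vanish at an algebraically
independent family. -/
theorem AlgebraicIndependent.aeval_ne_zero_of_eval_ne_zero {ι K : Type*} [Field K] [CharZero K]
    {p : ι → K} (hind : AlgebraicIndependent ℚ p) (F : MvPolynomial ι ℚ) (q : ι → ℚ)
    (hF : MvPolynomial.eval q F ≠ 0) : MvPolynomial.aeval p F ≠ 0 := by
  intro h
  rw [(algebraicIndependent_iff.mp hind) F h] at hF
  simp at hF

/-- If `p₀, p₁, p₂, p₃` are distinct and `p₀ + p₁ ≠ p₂ + p₃`, there are two distinct points `r`, `s`,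
different from all `pᵢ`, which are harmonic conjugates both with respect to `p₀, p₁` and with
respect to `p₂, p₃`; they are the roots of an explicit quadratic polynomial. -/
theorem exists_common_harmonic_pair {K : Type*} [Field K] [IsAlgClosed K] [CharZero K]
    {p₀ p₁ p₂ p₃ : K} (h01 : p₀ ≠ p₁) (h02 : p₀ ≠ p₂) (h03 : p₀ ≠ p₃) (h12 : p₁ ≠ p₂)
    (h13 : p₁ ≠ p₃) (h23 : p₂ ≠ p₃) (hD : p₀ + p₁ - p₂ - p₃ ≠ 0) :
    ∃ r s : K, r ≠ s ∧
      (∀ x, (p₀ + p₁ - p₂ - p₃) * ((x - r) * (x - s)) =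
        x ^ 2 * (p₀ + p₁ - p₂ - p₃) - 2 * x * (p₀ * p₁ - p₂ * p₃) +
          (p₀ * p₁ * (p₂ + p₃) - (p₀ + p₁) * (p₂ * p₃))) ∧
      (∀ x ∈ ({p₀, p₁, p₂, p₃} : Set K), (x - r) * (x - s) ≠ 0) ∧
      (p₁ - r) * (p₀ - s) + (p₀ - r) * (p₁ - s) = 0 ∧
      (p₃ - r) * (p₂ - s) + (p₂ - r) * (p₃ - s) = 0 := by
  obtain ⟨e, he⟩ := IsAlgClosed.exists_pow_nat_eq
    ((p₀ - p₂) * (p₀ - p₃) * (p₁ - p₂) * (p₁ - p₃)) two_pos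
  have he0 : e ≠ 0 := by
    rintro rfl
    have : (p₀ - p₂) * (p₀ - p₃) * (p₁ - p₂) * (p₁ - p₃) ≠ 0 := by
      simp [sub_eq_zero, h02, h03, h12, h13]
    exact this (by rw [← he]; simp)
  obtain ⟨r, hr⟩ : ∃ r, (p₀ + p₁ - p₂ - p₃) * r = p₀ * p₁ - p₂ * p₃ + e :=
    ⟨_, mul_div_cancel₀ _ hD⟩
  obtain ⟨s, hs⟩ : ∃ s, (p₀ + p₁ - p₂ - p₃) * s = p₀ * p₁ - p₂ * p₃ - e :=
    ⟨_, mul_div_cancel₀ _ hD⟩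
  have hsum : (p₀ + p₁ - p₂ - p₃) * (r + s) = 2 * (p₀ * p₁ - p₂ * p₃) := by
    linear_combination hr + hs
  have hprod : (p₀ + p₁ - p₂ - p₃) * (r * s) =
      p₀ * p₁ * (p₂ + p₃) - (p₀ + p₁) * (p₂ * p₃) := by
    apply mul_left_cancel₀ hD
    linear_combination (p₀ + p₁ - p₂ - p₃) * s * hr + (p₀ * p₁ - p₂ * p₃ + e) * hs - he
  have hquad : ∀ x, (p₀ + p₁ - p₂ - p₃) * ((x - r) * (x - s)) =
      x ^ 2 * (p₀ + p₁ - p₂ - p₃) - 2 * x * (p₀ * p₁ - p₂ * p₃) +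
        (p₀ * p₁ * (p₂ + p₃) - (p₀ + p₁) * (p₂ * p₃)) := fun x => by
    linear_combination hprod - x * hsum
  refine ⟨r, s, ?_, hquad, ?_, ?_, ?_⟩
  · rintro rfl
    have : 2 * e = 0 := by linear_combination hs - hr
    simp [he0] at this
  · intro x hx h0
    have hx0 := hquad x
    rw [h0, mul_zero] at hx0
    rcases hx with rfl | rfl | rfl | rfl
    · have : (x - p₁) * (x - p₂) * (x - p₃) = 0 := by linear_combination -hx0
      simp [sub_eq_zero, h01, h02, h03] at this
    · have : (x - p₀) * (x - p₂) * (x - p₃) = 0 := by linear_combination -hx0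
      simp [sub_eq_zero, h01.symm, h12, h13] at this
    · have : (x - p₀) * (x - p₁) * (x - p₃) = 0 := by linear_combination hx0
      simp [sub_eq_zero, h02.symm, h12.symm, h23] at this
    · have : (x - p₀) * (x - p₁) * (x - p₂) = 0 := by linear_combination hx0
      simp [sub_eq_zero, h03.symm, h13.symm, h23.symm] at this
  · apply mul_left_cancel₀ hD
    linear_combination 2 * hprod - (p₀ + p₁) * hsum
  · apply mul_left_cancel₀ hD
    linear_combination 2 * hprod - (p₂ + p₃) * hsum


/-- Let `K` be an algebraically closed field of characteristic `0` and
`p₁, …, p₆ ∈ K` algebraically independent over `ℚ`. Then there exist a fractional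
linear transformation `h(t) = (at+b)/(ct+d)` over `K` (with `ad − bc ≠ 0`,
defined at each `pᵢ`) and `x₁, x₂, v ∈ K` with `v ≠ 0` such that
`h(p₁) = x₁`, `h(p₂) = −x₁`, `h(p₃) = x₂`, `h(p₄) = −x₂`, `h(p₅) = v`,
`h(p₆) = 1/v`. -/
theorem stmt_12 {K : Type*} [Field K] [IsAlgClosed K] [CharZero K]
    (p : Fin 6 → K) (hind : AlgebraicIndependent ℚ p) :
    ∃ a b c d x₁ x₂ v : K, a * d - b * c ≠ 0 ∧ v ≠ 0 ∧
      (∀ i : Fin 6, c * p i + d ≠ 0) ∧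
      (a * p 0 + b) / (c * p 0 + d) = x₁ ∧
      (a * p 1 + b) / (c * p 1 + d) = -x₁ ∧
      (a * p 2 + b) / (c * p 2 + d) = x₂ ∧
      (a * p 3 + b) / (c * p 3 + d) = -x₂ ∧
      (a * p 4 + b) / (c * p 4 + d) = v ∧
      (a * p 5 + b) / (c * p 5 + d) = 1 / v := by
  have hinj := hind.injective
  have hne : ∀ i j : Fin 6, i ≠ j → p i ≠ p j := fun i j hij h => hij (hinj h)
  have hD : p 0 + p 1 - p 2 - p 3 ≠ 0 := by
    have := hind.aeval_ne_zero_of_eval_ne_zero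
      (.X 0 + .X 1 - .X 2 - .X 3) ![0, 1, 2, 4, 7, 11] (by simp; norm_num)
    simpa using this
  obtain ⟨r, s, hrs, hquad, hfix, h01, h23⟩ := exists_common_harmonic_pair
    (hne 0 1 (by decide)) (hne 0 2 (by decide)) (hne 0 3 (by decide)) (hne 1 2 (by decide))
    (hne 1 3 (by decide)) (hne 2 3 (by decide)) hD
  have h4 : (p 4 - r) * (p 4 - s) ≠ 0 := by
    refine right_ne_zero_of_mul (a := p 0 + p 1 - p 2 - p 3) ?_
    rw [hquad]
    have := hind.aeval_ne_zero_of_eval_ne_zero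
      (.X 4 ^ 2 * (.X 0 + .X 1 - .X 2 - .X 3) - 2 * .X 4 * (.X 0 * .X 1 - .X 2 * .X 3) +
        (.X 0 * .X 1 * (.X 2 + .X 3) - (.X 0 + .X 1) * (.X 2 * .X 3)))
      ![0, 1, 2, 4, 7, 11] (by simp; norm_num)
    simpa using this
  have h5 : (p 5 - r) * (p 5 - s) ≠ 0 := by
    refine right_ne_zero_of_mul (a := p 0 + p 1 - p 2 - p 3) ?_
    rw [hquad]
    have := hind.aeval_ne_zero_of_eval_ne_zero
      (.X 5 ^ 2 * (.X 0 + .X 1 - .X 2 - .X 3) - 2 * .X 5 * (.X 0 * .X 1 - .X 2 * .X 3) +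
        (.X 0 * .X 1 * (.X 2 + .X 3) - (.X 0 + .X 1) * (.X 2 * .X 3)))
      ![0, 1, 2, 4, 7, 11] (by simp; norm_num)
    simpa using this
  have hs : ∀ i, p i - s ≠ 0 := by
    intro i
    fin_cases i
    · exact right_ne_zero_of_mul (hfix (p 0) (by simp))
    · exact right_ne_zero_of_mul (hfix (p 1) (by simp))
    · exact right_ne_zero_of_mul (hfix (p 2) (by simp))
    · exact right_ne_zero_of_mul (hfix (p 3) (by simp))
    · exact right_ne_zero_of_mul h4
    · exact right_ne_zero_of_mul h5
  have hr4 := left_ne_zero_of_mul h4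
  have hr5 := left_ne_zero_of_mul h5
  obtain ⟨μ, hμ⟩ := IsAlgClosed.exists_pow_nat_eq
    ((p 4 - s) * (p 5 - s) / ((p 4 - r) * (p 5 - r))) two_pos
  have hμ0 : μ ≠ 0 := by
    rintro rfl
    have : (p 4 - s) * (p 5 - s) / ((p 4 - r) * (p 5 - r)) ≠ 0 :=
      div_ne_zero (mul_ne_zero (hs 4) (hs 5)) (mul_ne_zero hr4 hr5)
    exact this (by rw [← hμ]; simp)
  rw [eq_div_iff (mul_ne_zero hr4 hr5)] at hμ
  have hden : ∀ i, 1 * p i + -s = p i - s := fun i => by ring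
  have hnum : ∀ i, μ * p i + -(μ * r) = μ * (p i - r) := fun i => by ring
  refine ⟨μ, -(μ * r), 1, -s, μ * (p 0 - r) / (p 0 - s), μ * (p 2 - r) / (p 2 - s),
    μ * (p 4 - r) / (p 4 - s), ?_, div_ne_zero (mul_ne_zero hμ0 hr4) (hs 4), ?_, ?_⟩
  · rw [show μ * -s - -(μ * r) * 1 = μ * (r - s) by ring]
    exact mul_ne_zero hμ0 (sub_ne_zero.mpr hrs)
  · intro i
    rw [hden]
    exact hs i
  · simp only [hden, hnum]
    refine ⟨trivial, ?_, trivial, ?_, trivial, ?_⟩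
    · rw [← neg_div, div_eq_div_iff (hs 1) (hs 0)]
      linear_combination μ * h01
    · rw [← neg_div, div_eq_div_iff (hs 3) (hs 2)]
      linear_combination μ * h23
    · rw [one_div_div, div_eq_div_iff (hs 5) (mul_ne_zero hμ0 hr4)]
      linear_combination hμ
end

section
/- Let z₀ = −(1 + 2i·cos(π/7))·(1 + 2i·cos(3π/7))·(1 + 2i·cos(5π/7)) ∈ ℂ. Then z₀ · conj(z₀) = 13; equivalently, (1 + 4cos²(π/7))·(1 + 4cos²(3π/7))·(1 + 4cos²(5π/7)) = 13, so z₀ is a Weil number of absolute value √13. -/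
open Real Complex

lemma cos_pi_div_seven_root :
    8 * Real.cos (π / 7) ^ 3 - 4 * Real.cos (π / 7) ^ 2 - 4 * Real.cos (π / 7) + 1 = 0 := by
  have hpos : 0 < Real.cos (π / 7) :=
    Real.cos_pos_of_mem_Ioo ⟨by linarith [Real.pi_pos], by linarith [Real.pi_pos]⟩
  have h : Real.cos (3 * (π / 7)) = -Real.cos (2 * (2 * (π / 7))) := by
    rw [← Real.cos_pi_sub]
    congr 1
    ring
  rw [Real.cos_three_mul, Real.cos_two_mul, Real.cos_two_mul] at h
  have hne : Real.cos (π / 7) + 1 ≠ 0 := by positivity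
  apply mul_left_cancel₀ hne
  linear_combination h

lemma cos_three_pi_div_seven :
    Real.cos (3 * π / 7) = 2 * Real.cos (π / 7) ^ 2 - Real.cos (π / 7) - 1 / 2 := by
  rw [mul_div_assoc, Real.cos_three_mul]
  linear_combination (1 / 2) * cos_pi_div_seven_root

lemma cos_five_pi_div_seven :
    Real.cos (5 * π / 7) = 1 - 2 * Real.cos (π / 7) ^ 2 := by
  rw [show 5 * π / 7 = π - 2 * (π / 7) by ring, Real.cos_pi_sub, Real.cos_two_mul]
  ring

lemma prod_one_add_four_mul_cos_sq :
    (1 + 4 * Real.cos (π / 7) ^ 2) * (1 + 4 * Real.cos (3 * π / 7) ^ 2) *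
      (1 + 4 * Real.cos (5 * π / 7) ^ 2) = 13 := by
  rw [cos_three_pi_div_seven, cos_five_pi_div_seven]
  have h := cos_pi_div_seven_root
  generalize Real.cos (π / 7) = c at h ⊢
  linear_combination
    (128 * c ^ 7 - 64 * c ^ 6 - 96 * c ^ 5 + 32 * c ^ 4
      + 24 * c ^ 3 + 8 * c ^ 2 + 8 * c - 3) * h

lemma one_add_two_I_mul_mul_conj (x : ℝ) :
    (1 + 2 * Complex.I * (x : ℂ)) * (starRingEnd ℂ) (1 + 2 * Complex.I * (x : ℂ)) =
      ((1 + 4 * x ^ 2 : ℝ) : ℂ) := by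
  simp only [map_add, map_mul, map_one, map_ofNat, Complex.conj_I, Complex.conj_ofReal]
  push_cast
  linear_combination (-4 * (x : ℂ) ^ 2) * Complex.I_sq

/-- Let `z₀ = −(1 + 2i·cos(π/7))·(1 + 2i·cos(3π/7))·(1 + 2i·cos(5π/7)) ∈ ℂ`.
Then `z₀ · conj(z₀) = 13`; equivalently
`(1 + 4cos²(π/7))·(1 + 4cos²(3π/7))·(1 + 4cos²(5π/7)) = 13`, so `z₀` is a Weil
number of absolute value `√13`. -/
theorem stmt_14 :
    letI z₀ : ℂ :=
      -((1 + 2 * Complex.I * (Real.cos (π / 7) : ℂ)) *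
        (1 + 2 * Complex.I * (Real.cos (3 * π / 7) : ℂ)) *
        (1 + 2 * Complex.I * (Real.cos (5 * π / 7) : ℂ)))
    z₀ * (starRingEnd ℂ) z₀ = 13 ∧
      (1 + 4 * Real.cos (π / 7) ^ 2) * (1 + 4 * Real.cos (3 * π / 7) ^ 2) *
        (1 + 4 * Real.cos (5 * π / 7) ^ 2) = 13 := by
  refine ⟨?_, prod_one_add_four_mul_cos_sq⟩
  rw [map_neg, neg_mul_neg, map_mul, map_mul, mul_mul_mul_comm,
    mul_mul_mul_comm (1 + 2 * Complex.I * (Real.cos (π / 7) : ℂ)),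
    one_add_two_I_mul_mul_conj, one_add_two_I_mul_mul_conj, one_add_two_I_mul_mul_conj,
    ← Complex.ofReal_mul, ← Complex.ofReal_mul, prod_one_add_four_mul_cos_sq]
  norm_num
end

section
/- Let F be the subfield of ℂ generated over ℚ by i and 2cos(2π/7) (i.e. F = ℚ(i, 2cos(2π/7))). If ζ ∈ F is a root of unity (ζⁿ = 1 for some positive integer n), then ζ⁴ = 1; that is, the only roots of unity in ℚ(i, 2cos(2π/7)) are ±1 and ±i. -/
open Real Complex

/-- Every root of unity in the `n`-th cyclotomic field, `n` even, is an `n`-th root of unity. -/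
theorem pow_eq_one_of_isCyclotomicExtension {n : ℕ} [NeZero n] (hn : Even n) {K : Type*} [Field K]
    [NumberField K] [IsCyclotomicExtension {n} ℚ K] {x : K} {m : ℕ} (hm : 0 < m)
    (hx : x ^ m = 1) : x ^ n = 1 := by
  have : NeZero (orderOf x) := ⟨(orderOf_pos_iff.2 (isOfFinOrder_iff_pow_eq_one.2 ⟨m, hm, hx⟩)).ne'⟩
  have h := NumberField.Units.dvd_torsionOrder_of_isPrimitiveRoot (IsPrimitiveRoot.orderOf x)
  rw [IsCyclotomicExtension.Rat.torsionOrder_eq (n := n) (K := K), if_pos hn] at h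
  exact orderOf_dvd_iff_pow_eq_one.1 h

theorem exp_two_pi_mul_I_div_twentyEight_pow_seven :
    Complex.exp (2 * π * I / 28) ^ 7 = I := by
  rw [← Complex.exp_nat_mul]
  refine Eq.trans (congrArg _ ?_) Complex.exp_pi_div_two_mul_I
  push_cast
  ring

theorem exp_two_pi_mul_I_div_twentyEight_pow_four_add_inv :
    Complex.exp (2 * π * I / 28) ^ 4 + (Complex.exp (2 * π * I / 28) ^ 4)⁻¹ =
      ((2 * Real.cos (2 * π / 7) : ℝ) : ℂ) := by
  rw [← Complex.exp_nat_mul, ← Complex.exp_neg]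
  push_cast
  rw [Complex.two_cos]
  congr 2 <;> ring

/-- Let `F = ℚ(i, 2cos(2π/7))` be the subfield of `ℂ` generated over `ℚ` by `i`
and `2cos(2π/7)` (the smallest subfield of `ℂ` containing these elements; it
automatically contains `ℚ`). If `ζ ∈ F` is a root of unity, then `ζ⁴ = 1`:
the only roots of unity in `F` are `±1` and `±i`. -/
theorem stmt_15 (ζ : ℂ)
    (hζ : ζ ∈ Subfield.closure {Complex.I, ((2 * Real.cos (2 * π / 7) : ℝ) : ℂ)})
    (n : ℕ) (hn : 0 < n) (hroot : ζ ^ n = 1) :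
    ζ ^ 4 = 1 := by
  have hw : IsPrimitiveRoot (Complex.exp (2 * π * I / 28)) 28 := by
    exact_mod_cast Complex.isPrimitiveRoot_exp 28 (by norm_num)
  have hI := exp_two_pi_mul_I_div_twentyEight_pow_seven
  have hcos := exp_two_pi_mul_I_div_twentyEight_pow_four_add_inv
  set w := Complex.exp (2 * π * I / 28)
  let K := IntermediateField.adjoin ℚ {w}
  have : IsCyclotomicExtension {28} ℚ K := by
    change IsCyclotomicExtension {28} ℚ K.toSubalgebra
    have hint : IsIntegral ℚ w := (hw.isIntegral (by norm_num)).tower_top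
    rw [IntermediateField.adjoin_simple_toSubalgebra_of_isAlgebraic hint.isAlgebraic]
    exact hw.adjoin_isCyclotomicExtension ℚ
  have : NumberField K := IsCyclotomicExtension.numberField {28} ℚ K
  obtain ⟨w', hw'⟩ : ∃ w' : K, (w' : ℂ) = w :=
    ⟨⟨w, IntermediateField.mem_adjoin_simple_self ℚ w⟩, rfl⟩
  have hw'28 : w' ^ 28 = 1 := by
    apply Subtype.ext
    simpa [hw'] using hw.pow_eq_one
  obtain ⟨σ, hσ⟩ := (IsCyclotomicExtension.Rat.galEquivZMod 28 K).surjective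
    (ZMod.unitOfCoprime 13 (by norm_num))
  have hσ_pow {x : K} (hx : x ^ 28 = 1) : σ x = x ^ 13 := by
    rw [IsCyclotomicExtension.Rat.galEquivZMod_apply_of_pow_eq 28 K σ hx, hσ]
    rfl
  have hle : Subfield.closure {I, ((2 * Real.cos (2 * π / 7) : ℝ) : ℂ)} ≤
      ((σ : K →+* K).eqLocusField (RingHom.id K)).map (algebraMap K ℂ) := by
    rw [Subfield.closure_le, Set.insert_subset_iff, Set.singleton_subset_iff]
    refine ⟨⟨w' ^ 7, ?_, by simp [hw', hI]⟩, ⟨w' ^ 4 + (w' ^ 4)⁻¹, ?_, by simp [hw', ← hcos]⟩⟩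
    · change σ (w' ^ 7) = w' ^ 7
      rw [map_pow, hσ_pow hw'28]
      linear_combination (w' ^ 63 + w' ^ 35 + w' ^ 7) * hw'28
    · change σ (w' ^ 4 + (w' ^ 4)⁻¹) = w' ^ 4 + (w' ^ 4)⁻¹
      have h : (w' ^ 13) ^ 4 = (w' ^ 4)⁻¹ := by
        refine eq_inv_of_mul_eq_one_left ?_
        linear_combination (w' ^ 28 + 1) * hw'28
      rw [map_add, map_inv₀, map_pow, hσ_pow hw'28, h, inv_inv, add_comm]
  obtain ⟨z, hz, rfl⟩ := hle hζ
  replace hz : σ z = z := hz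
  have hz_root : z ^ n = 1 := (algebraMap K ℂ).injective (by rw [map_pow, hroot, map_one])
  have hz28 : z ^ 28 = 1 := pow_eq_one_of_isCyclotomicExtension (by decide) hn hz_root
  have hz0 : z ≠ 0 := by
    rintro rfl
    norm_num at hz28
  have hz12 : z ^ 12 = 1 := by
    refine mul_right_cancel₀ hz0 ?_
    rw [← pow_succ, ← hσ_pow hz28, hz, one_mul]
  have hz4 : z ^ 4 = 1 := by
    simpa using pow_gcd_eq_one.2 ⟨hz28, hz12⟩
  rw [← map_pow, hz4, map_one]
end
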